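/- arXiv:1207.5258 — 2 statements merged into one kernel-verified Lean document; each statement's English description precedes it below -/
import Mathlib

section
/- Let p ≥ 1 be an integer, Q ⊆ ℝⁿ a closed set, f : ℝⁿ → ℝ continuous, ε : ℝⁿ → (0,∞) continuous, and let 𝒜 be a C^{p+1}-stratification of Q with m strata that is normally flat. Then there exists a C^p-smooth function g : ℝⁿ → ℝ satisfying simultaneously: |f(x) − g(x)| < ε(x) for all x ∈ ℝⁿ; for every stratum M ∈ 𝒜 and every x ∈ M, the gradient ∇g(x) lies in T_xM; if f is κ-Lipschitz then g can be chosen 13^{m+1}·κ-Lipschitz; given any open neighborhood V₁ of the support of f, g can be chosen with support in V₁; and (boundary behavior) for every stratum M ∈ 𝒜, every x ∈ M, and every normal vector v ∈ N_xM, there exists η > 0 such that g(x + t·v) = g(x) for all real t with |t| < η. -/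
open Filter Topology Metric

noncomputable section

/-- `M ⊆ ℝⁿ` is a `C^p` manifold of dimension `d`: around each of its points it is the zero
set of a `C^p` map into `ℝ^(n-d)` whose derivative is surjective. -/
def IsCpManifold (n : ℕ) (p : ℕ∞) (d : ℕ) (M : Set (EuclideanSpace ℝ (Fin n))) : Prop :=
  ∀ x ∈ M, ∃ (U : Set (EuclideanSpace ℝ (Fin n)))
    (F : EuclideanSpace ℝ (Fin n) → EuclideanSpace ℝ (Fin (n - d))),
    IsOpen U ∧ x ∈ U ∧ ContDiffOn ℝ p F U ∧ M ∩ U = U ∩ F ⁻¹' {0} ∧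
      Function.Surjective (fderiv ℝ F x)

/-- The tangent space of `M` at `x`: the linear span of the tangent cone. -/
def tangentSp (n : ℕ) (M : Set (EuclideanSpace ℝ (Fin n))) (x : EuclideanSpace ℝ (Fin n)) :
    Submodule ℝ (EuclideanSpace ℝ (Fin n)) :=
  Submodule.span ℝ (tangentConeAt ℝ M x)

/-- The normal space of `M` at `x`: the orthogonal complement of the tangent space. -/
def normalSp (n : ℕ) (M : Set (EuclideanSpace ℝ (Fin n))) (x : EuclideanSpace ℝ (Fin n)) :
    Submodule ℝ (EuclideanSpace ℝ (Fin n)) :=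
  (tangentSp n M x)ᗮ

/-- A `C^p`-stratification of `Q ⊆ ℝⁿ`: a partition of `Q` into finitely many `C^p` manifolds
satisfying the frontier condition, with the dimension decreasing along frontiers. -/
structure CpStratification (n : ℕ) (p : ℕ∞) (Q : Set (EuclideanSpace ℝ (Fin n))) where
  strata : Finset (Set (EuclideanSpace ℝ (Fin n)))
  dim : Set (EuclideanSpace ℝ (Fin n)) → ℕ
  isManifold : ∀ M ∈ strata, IsCpManifold n p (dim M) M
  covers : ⋃₀ (strata : Set (Set (EuclideanSpace ℝ (Fin n)))) = Q
  pairwiseDisjoint : ∀ M ∈ strata, ∀ L ∈ strata, M ≠ L → Disjoint M L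
  frontierCond : ∀ L ∈ strata, ∀ M ∈ strata, L ≠ M → (L ∩ closure M).Nonempty →
    L ⊆ closure M \ M
  dim_lt : ∀ L ∈ strata, ∀ M ∈ strata, L ≠ M → L ⊆ closure M \ M → dim L < dim M


/-- The metric projection of `x` onto a set `S`: the set of nearest points of `S` to `x`. -/
def metricProj {n : ℕ} (S : Set (EuclideanSpace ℝ (Fin n))) (x : EuclideanSpace ℝ (Fin n)) :
    Set (EuclideanSpace ℝ (Fin n)) :=
  {y ∈ S | dist x y = Metric.infDist x S}

/-- A stratification is normally flat if, for strata `L ⊆ (cl M) \ M`, near `L` and `M`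
projecting onto `L` is the same as first projecting onto `M` and then onto `L`. -/
def NormallyFlat {n : ℕ} {p : ℕ∞} {Q : Set (EuclideanSpace ℝ (Fin n))}
    (A : CpStratification n p Q) : Prop :=
  ∀ L ∈ A.strata, ∀ M ∈ A.strata, L ⊆ closure M \ M →
    ∃ V U : Set (EuclideanSpace ℝ (Fin n)), IsOpen V ∧ IsOpen U ∧ L ⊆ V ∧ M ⊆ U ∧
      ∀ x ∈ V ∩ U, metricProj L x = ⋃ z ∈ metricProj M x, metricProj L z

theorem exists_contDiff_log_cutoff :
    ∃ θ : ℝ → ℝ, ContDiff ℝ (⊤ : ℕ∞) θ ∧ (∀ s, 0 ≤ θ s) ∧ (∀ s, θ s ≤ 1) ∧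
      (∃ a > 0, ∀ s, |s| < a → θ s = 1) ∧ (∀ s, 1 ≤ s → θ s = 0) ∧
      (∀ s, 1 ≤ s → deriv θ s = 0) ∧ (∀ s, |s * deriv θ s| ≤ 1) := by
  have hS : ContDiff ℝ (⊤ : ℕ∞) Real.smoothTransition := Real.smoothTransition.contDiff
  obtain ⟨B, hB⟩ : ∃ B, ∀ u, |deriv Real.smoothTransition u| ≤ B := by
    have hc : Continuous (deriv Real.smoothTransition) := hS.continuous_deriv (by simp)
    obtain ⟨B, hB⟩ := (isCompact_Icc (a := (0 : ℝ)) (b := 1)).exists_bound_of_continuousOn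
      hc.continuousOn
    refine ⟨max B 0, fun u => ?_⟩
    by_cases hu : u ∈ Set.Icc (0 : ℝ) 1
    · exact (hB u hu).trans (le_max_left _ _)
    · have : deriv Real.smoothTransition u = 0 := by
        rcases not_and_or.1 hu with h | h
        · have : Real.smoothTransition =ᶠ[𝓝 u] fun _ => 0 := by
            filter_upwards [Iio_mem_nhds (not_le.1 h)] with v hv
            exact Real.smoothTransition.zero_of_nonpos (le_of_lt hv)
          simp [this.deriv_eq]
        · have : Real.smoothTransition =ᶠ[𝓝 u] fun _ => 1 := by
            filter_upwards [Ioi_mem_nhds (not_le.1 h)] with v hv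
            exact Real.smoothTransition.one_of_one_le (le_of_lt hv)
          simp [this.deriv_eq]
      simp [this]
  set R : ℝ := 2 * (|B| + 1) with hR
  have hR0 : 0 < R := by positivity
  set b : ℝ := Real.exp (-R) / 2 with hb
  have hb0 : 0 < b := by positivity
  let θ : ℝ → ℝ := fun s => 1 - Real.smoothTransition (1 + Real.log (s ^ 2 + b) / R)
  have hpos : ∀ s : ℝ, 0 < s ^ 2 + b := fun s => by positivity
  have hlog : ContDiff ℝ (⊤ : ℕ∞) fun s : ℝ => 1 + Real.log (s ^ 2 + b) / R :=
    contDiff_const.add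
      (((((contDiff_id.pow 2).add contDiff_const)).log fun s => (hpos s).ne').div_const R)
  have hder : ∀ s, deriv θ s = -(deriv Real.smoothTransition (1 + Real.log (s ^ 2 + b) / R) *
      ((2 * s) / (s ^ 2 + b) / R)) := by
    intro s
    have h1 : HasDerivAt (fun s : ℝ => s ^ 2 + b) (2 * s) s := by
      simpa using (hasDerivAt_pow 2 s).add_const b
    have h2 := ((h1.log (hpos s).ne').div_const R).const_add 1
    have h3 := ((hS.differentiable (by simp)) (1 + Real.log (s ^ 2 + b) / R)).hasDerivAt.comp s h2
    exact (h3.const_sub 1).deriv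
  refine ⟨θ, contDiff_const.sub (hS.comp hlog), fun s => ?_, fun s => ?_, ?_, ?_, ?_, ?_⟩
  · exact sub_nonneg.2 (Real.smoothTransition.le_one _)
  · exact sub_le_self _ (Real.smoothTransition.nonneg _)
  · refine ⟨√b, by positivity, fun s hs => ?_⟩
    have h1 : s ^ 2 + b ≤ Real.exp (-R) := by
      have : s ^ 2 < b := (Real.sq_lt).2 (abs_lt.1 hs)
      linarith
    have h2 : Real.log (s ^ 2 + b) ≤ -R := by
      simpa using Real.log_le_log (hpos s) h1
    have h3 : 1 + Real.log (s ^ 2 + b) / R ≤ 0 := by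
      have := div_le_div_of_nonneg_right h2 hR0.le
      rw [neg_div, div_self hR0.ne'] at this
      linarith
    simp [θ, Real.smoothTransition.zero_of_nonpos h3]
  · intro s hs
    have h2 : 0 ≤ Real.log (s ^ 2 + b) := Real.log_nonneg (by nlinarith)
    have h3 : 1 ≤ 1 + Real.log (s ^ 2 + b) / R := by
      have := div_nonneg h2 hR0.le
      linarith
    simp [θ, Real.smoothTransition.one_of_one_le h3]
  · intro s hs
    have h2 : 0 < Real.log (s ^ 2 + b) := Real.log_pos (by nlinarith)
    have h3 : 1 < 1 + Real.log (s ^ 2 + b) / R := by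
      have := div_pos h2 hR0
      linarith
    have : Real.smoothTransition =ᶠ[𝓝 (1 + Real.log (s ^ 2 + b) / R)] fun _ => 1 := by
      filter_upwards [Ioi_mem_nhds h3] with v hv
      exact Real.smoothTransition.one_of_one_le (le_of_lt hv)
    simp [hder, this.deriv_eq]
  · intro s
    rw [hder]
    have h1 : |deriv Real.smoothTransition (1 + Real.log (s ^ 2 + b) / R)| ≤ |B| :=
      (hB _).trans (le_abs_self B)
    have h2 : |s * ((2 * s) / (s ^ 2 + b) / R)| ≤ 2 / R := by
      have : s * ((2 * s) / (s ^ 2 + b) / R) = (s ^ 2 / (s ^ 2 + b)) * (2 / R) := by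
        have := (hpos s).ne'
        field_simp
      rw [this, abs_of_nonneg (by positivity)]
      have : s ^ 2 / (s ^ 2 + b) ≤ 1 := (div_le_one (hpos s)).2 (by linarith)
      exact mul_le_of_le_one_left (by positivity) this
    calc _ = |deriv Real.smoothTransition (1 + Real.log (s ^ 2 + b) / R)| *
          |s * ((2 * s) / (s ^ 2 + b) / R)| := by
          rw [← abs_mul, ← abs_neg]; congr 1; ring
      _ ≤ |B| * (2 / R) := by gcongr
      _ ≤ 1 := by
          rw [hR]
          have : 0 ≤ |B| := abs_nonneg B
          rw [← mul_div_assoc, div_le_one (by positivity)]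
          linarith

theorem exists_contDiff_small {E : Type*} [NormedAddCommGroup E] [NormedSpace ℝ E]
    [FiniteDimensional ℝ E] {O : Set E} (hO : IsOpen O) (P : E → ℝ → Prop)
    (hP : ∀ x ∈ O, ∃ c > 0, ∀ᶠ y in 𝓝 x, ∀ s, 0 < s → s ≤ c → P y s)
    {κ : NNReal} (hκ : 0 < κ) :
    ∃ r : E → ℝ, ContDiff ℝ (⊤ : ℕ∞) r ∧ (∀ x, 0 ≤ r x) ∧ (∀ x, x ∈ O ↔ 0 < r x) ∧
      (∀ x ∈ O, P x (r x)) ∧ LipschitzWith κ r := by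
  rcases Set.eq_empty_or_nonempty O with (rfl | hne)
  · exact ⟨fun _ => 0, contDiff_const, by simp, by simp, by simp, LipschitzWith.const' 0⟩
  let ι := { f : E → ℝ // (Function.support f ⊆ O ∧ ∃ c > 0, ∀ y ∈ Function.support f,
      ∀ s, 0 < s → s ≤ c → P y s) ∧
    HasCompactSupport f ∧ ContDiff ℝ (⊤ : ℕ∞) f ∧ Set.range f ⊆ Set.Icc 0 1 }
  obtain ⟨T, T_count, hT⟩ :
      ∃ T : Set ι, T.Countable ∧ ⋃ f ∈ T, Function.support (f : E → ℝ) = O := by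
    have : ⋃ f : ι, Function.support (f : E → ℝ) = O := by
      refine Set.Subset.antisymm (Set.iUnion_subset fun f => f.2.1.1) ?_
      intro x hx
      obtain ⟨c, hc, hev⟩ := hP x hx
      rcases exists_contDiff_tsupport_subset (n := ⊤) (Filter.inter_mem (hO.mem_nhds hx) hev)
        with ⟨f, hf⟩
      have hf1 := (subset_tsupport f).trans hf.1
      let g : ι := ⟨f, ⟨hf1.trans Set.inter_subset_left, c, hc, fun y hy => (hf1 hy).2⟩,
        hf.2.1, hf.2.2.1, hf.2.2.2.1⟩
      have : x ∈ Function.support (g : E → ℝ) := by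
        simp only [g, hf.2.2.2.2, Function.mem_support, Ne, one_ne_zero, not_false_iff]
      exact Set.mem_iUnion_of_mem _ this
    simp_rw [← this]
    apply TopologicalSpace.isOpen_iUnion_countable
    rintro ⟨f, hf⟩
    exact hf.2.2.1.continuous.isOpen_support
  obtain ⟨g0, hg⟩ : ∃ g0 : ℕ → ι, T = Set.range g0 := by
    apply Set.Countable.exists_eq_range T_count
    rcases Set.eq_empty_or_nonempty T with (rfl | hT')
    · simp only [← hT, Set.mem_empty_iff_false, Set.iUnion_of_empty, Set.iUnion_empty,
        Set.not_nonempty_empty] at hne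
    · exact hT'
  let g : ℕ → E → ℝ := fun n => (g0 n).1
  have g_s : ∀ n, Function.support (g n) ⊆ O := fun n => (g0 n).2.1.1
  have s_g : ∀ x ∈ O, ∃ n, x ∈ Function.support (g n) := fun x hx ↦ by
    rw [← hT] at hx
    obtain ⟨i, iT, hi⟩ : ∃ i ∈ T, x ∈ Function.support (i : E → ℝ) := by
      simpa only [Set.mem_iUnion, exists_prop] using! hx
    obtain ⟨n, hn⟩ := hg ▸ iT
    exact ⟨n, by simpa [g, hn] using hi⟩
  have g_c : ∀ n, ∃ c > 0, ∀ y ∈ Function.support (g n), ∀ s, 0 < s → s ≤ c → P y s :=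
    fun n => (g0 n).2.1.2
  choose c c_pos hc using g_c
  have g_smooth : ∀ n, ContDiff ℝ (⊤ : ℕ∞) (g n) := fun n => (g0 n).2.2.2.1
  have g_comp_supp : ∀ n, HasCompactSupport (g n) := fun n => (g0 n).2.2.1
  have g_nonneg : ∀ n x, 0 ≤ g n x := fun n x => ((g0 n).2.2.2.2 (Set.mem_range_self x)).1
  obtain ⟨δ, δpos, C, δC, C_lt⟩ :
      ∃ δ : ℕ → NNReal, (∀ i : ℕ, 0 < δ i) ∧ ∃ C : NNReal, HasSum δ C ∧ C < 1 :=
    NNReal.exists_pos_sum_of_countable one_ne_zero ℕ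
  let e : ℕ → ℝ := fun n => min (min (c n) κ) 1
  have e_pos : ∀ n, 0 < e n := fun n => lt_min (lt_min (c_pos n) hκ) one_pos
  have e_one : ∀ n, e n ≤ 1 := fun n => min_le_right _ _
  have e_c : ∀ n, e n ≤ c n := fun n => (min_le_left _ _).trans (min_le_left _ _)
  have e_κ : ∀ n, e n ≤ κ := fun n => (min_le_left _ _).trans (min_le_right _ _)
  have : ∀ n : ℕ, ∃ r : ℝ, 0 < r ∧
      ∀ i ≤ n + 1, ∀ x, ‖iteratedFDeriv ℝ i (r • g n) x‖ ≤ δ n * e n := by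
    intro n
    have : ∀ i, ∃ R, ∀ x, ‖iteratedFDeriv ℝ i (fun x => g n x) x‖ ≤ R := by
      intro i
      have : BddAbove (Set.range fun x => ‖iteratedFDeriv ℝ i (fun x : E => g n x) x‖) := by
        apply ((g_smooth n).continuous_iteratedFDeriv
          (mod_cast le_top)).norm.bddAbove_range_of_hasCompactSupport
        apply HasCompactSupport.comp_left _ norm_zero
        apply (g_comp_supp n).iteratedFDeriv
      rcases this with ⟨R, hR⟩
      exact ⟨R, fun x => hR (Set.mem_range_self _)⟩
    choose R hR using this
    let M := max (((Finset.range (n + 2)).image R).max' (by simp)) 1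
    have hM : 0 < M := lt_of_lt_of_le one_pos (le_max_right _ _)
    have δnpos : 0 < (δ n : ℝ) := δpos n
    have epos := e_pos n
    have IR : ∀ i ≤ n + 1, R i ≤ M := by
      intro i hi
      refine le_trans ?_ (le_max_left _ _)
      apply Finset.le_max'
      apply Finset.mem_image_of_mem
      simp only [Finset.mem_range]
      lia
    refine ⟨M⁻¹ * (δ n * e n), by positivity, fun i hi x => ?_⟩
    calc
      ‖iteratedFDeriv ℝ i ((M⁻¹ * (δ n * e n)) • g n) x‖
          = ‖(M⁻¹ * (δ n * e n)) • iteratedFDeriv ℝ i (g n) x‖ := by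
        rw [iteratedFDeriv_const_smul_apply]
        exact (g_smooth n).contDiffAt.of_le (mod_cast le_top)
      _ = M⁻¹ * (δ n * e n) * ‖iteratedFDeriv ℝ i (g n) x‖ := by
        rw [norm_smul _ (iteratedFDeriv ℝ i (g n) x), Real.norm_of_nonneg]; positivity
      _ ≤ M⁻¹ * (δ n * e n) * M := by gcongr; exact (hR i x).trans (IR i hi)
      _ = δ n * e n := by field_simp
  choose r rpos hr using this
  have hsumδ : Summable fun n => (δ n : ℝ) := NNReal.summable_coe.2 δC.summable
  have hr' : ∀ n, ∀ i ≤ n + 1, ∀ x, ‖iteratedFDeriv ℝ i (r n • g n) x‖ ≤ δ n := fun n i hi x =>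
    (hr n i hi x).trans (mul_le_of_le_one_right (δ n).2 (e_one n))
  have hr0 : ∀ n x, r n * g n x ≤ δ n * e n := fun n x => by
    have := hr n 0 (by lia) x
    rw [norm_iteratedFDeriv_zero] at this
    exact (le_abs_self _).trans this
  have hn0 : ∀ n x, 0 ≤ r n * g n x := fun n x => mul_nonneg (rpos n).le (g_nonneg n x)
  have S : ∀ x, Summable fun n => r n * g n x := fun x =>
    Summable.of_nonneg_of_le (fun n => hn0 n x) (fun n => (hr0 n x).trans
      (mul_le_of_le_one_right (δ n).2 (e_one n))) hsumδ
  have hlip : ∀ n x y, |r n * g n x - r n * g n y| ≤ δ n * κ * dist x y := by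
    intro n x y
    have hd : Differentiable ℝ (r n • g n) :=
      ((g_smooth n).differentiable (by simp)).const_smul (r n)
    have : LipschitzWith (δ n * κ) (r n • g n) := by
      refine lipschitzWith_of_nnnorm_fderiv_le hd fun x => ?_
      rw [← NNReal.coe_le_coe, coe_nnnorm, ← norm_iteratedFDeriv_one]
      refine (hr n 1 (by lia) x).trans ?_
      push_cast
      gcongr
      exact e_κ n
    simpa [Real.dist_eq] using this.dist_le_mul x y
  have hposO : ∀ x ∈ O, 0 < ∑' n, r n * g n x := by
    intro x hx
    obtain ⟨n, hn⟩ := s_g x hx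
    exact (S x).tsum_pos (fun i => hn0 i x) n
      (mul_pos (rpos n) (lt_of_le_of_ne (g_nonneg n x) (Ne.symm hn)))
  refine ⟨fun x => ∑' n, r n * g n x, ?_, fun x => tsum_nonneg fun n => hn0 n x, ?_, ?_, ?_⟩
  · refine contDiff_tsum_of_eventually (f := fun n x => r n * g n x) (v := fun _ n => (δ n : ℝ))
      (fun n => contDiff_const.mul (g_smooth n)) (fun k _ => hsumδ) ?_
    intro i _
    simp only [Nat.cofinite_eq_atTop]
    filter_upwards [Filter.Ici_mem_atTop i] with n hn x
    exact hr' n i (by simp at hn; lia) x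
  · intro x
    refine ⟨hposO x, fun h => ?_⟩
    by_contra hx
    have : ∀ n, g n x = 0 := fun n => by
      by_contra hne
      exact hx (g_s n hne)
    simp [this] at h
  · intro x hx
    have h0 := hposO x hx
    obtain ⟨n, hn, hle⟩ : ∃ n, x ∈ Function.support (g n) ∧ ∑' n, r n * g n x ≤ c n := by
      by_contra! hcon
      have hle : ∑' n, r n * g n x ≤ ∑' n, (δ n : ℝ) * ∑' n, r n * g n x := by
        refine (S x).tsum_le_tsum (fun n => ?_) (hsumδ.mul_right _)
        by_cases hn : x ∈ Function.support (g n)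
        · refine (hr0 n x).trans ?_
          gcongr
          exact (e_c n).trans (hcon n hn).le
        · have : g n x = 0 := by simpa using hn
          rw [this, mul_zero]
          exact mul_nonneg (δ n).2 h0.le
      rw [tsum_mul_right] at hle
      have hC : ∑' n, (δ n : ℝ) = C := (NNReal.hasSum_coe.2 δC).tsum_eq
      rw [hC] at hle
      have hC1 : (C : ℝ) < 1 := C_lt
      nlinarith
    exact hc n x hn _ h0 hle
  · refine LipschitzWith.of_dist_le_mul fun x y => ?_
    rw [Real.dist_eq, ← (S x).tsum_sub (S y)]
    have hs2 : Summable fun n => (δ n : ℝ) * κ * dist x y := (hsumδ.mul_right _).mul_right _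
    have h1 : ‖∑' n, (r n * g n x - r n * g n y)‖ ≤ ∑' n, (δ n : ℝ) * κ * dist x y :=
      tsum_of_norm_bounded hs2.hasSum (fun n => hlip n x y)
    refine h1.trans ?_
    rw [tsum_mul_right, tsum_mul_right, (NNReal.hasSum_coe.2 δC).tsum_eq]
    have hC1 : (C : ℝ) ≤ 1 := C_lt.le
    gcongr
    exact mul_le_of_le_one_left κ.2 hC1

open MeasureTheory in
theorem exists_contDiff_mollification {n : ℕ} {f r : EuclideanSpace ℝ (Fin n) → ℝ}
    (hf : Continuous f) (hr : ContDiff ℝ (⊤ : ℕ∞) r) (hpos : ∀ x, 0 < r x) :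
    ∃ g : EuclideanSpace ℝ (Fin n) → ℝ, ContDiff ℝ (⊤ : ℕ∞) g ∧
      (∀ x c e, (∀ z, dist z x ≤ r x → |f z - c| ≤ e) → |g x - c| ≤ e) ∧
      ∀ K : NNReal, LipschitzWith K f → LipschitzWith 1 r → LipschitzWith (2 * K) g := by
  let φ : ContDiffBump (0 : EuclideanSpace ℝ (Fin n)) := ⟨1 / 2, 1, by norm_num, by norm_num⟩
  let ψ : EuclideanSpace ℝ (Fin n) → ℝ := φ.normed volume
  have ψ_smooth : ContDiff ℝ (⊤ : ℕ∞) ψ := φ.contDiff_normed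
  have ψ_nonneg : ∀ y, 0 ≤ ψ y := φ.nonneg_normed
  have ψ_int : ∫ y, ψ y = 1 := φ.integral_normed
  have ψ_supp : ∀ y, ψ y ≠ 0 → ‖y‖ < 1 := fun y hy => by
    have : y ∈ Function.support (φ.normed volume) := hy
    rw [φ.support_normed_eq] at this
    simpa using this
  have ψ_comp : HasCompactSupport ψ := φ.hasCompactSupport_normed
  have ψ_integrable : Integrable ψ := φ.integrable_normed
  have hint : ∀ x, Integrable fun y => ψ y * f (x - r x • y) := fun x =>
    Continuous.integrable_of_hasCompactSupport
      (ψ_smooth.continuous.mul (hf.comp (by fun_prop))) ψ_comp.mul_right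
  refine ⟨fun x => ∫ y, ψ y * f (x - r x • y), ?_, ?_, ?_⟩
  · rw [contDiff_iff_contDiffAt]
    intro x₀
    let K : ℝ → EuclideanSpace ℝ (Fin n) → ℝ := fun s u => ψ (s⁻¹ • u)
    set R := 2 * r x₀ with hR
    have hconv : ContDiffOn ℝ (⊤ : ℕ∞)
        (fun q : ℝ × EuclideanSpace ℝ (Fin n) =>
          (convolution f (K q.1) (ContinuousLinearMap.mul ℝ ℝ) volume) q.2)
        (Set.Ioo 0 R ×ˢ Set.univ) := by
      refine contDiffOn_convolution_right_with_param (ContinuousLinearMap.mul ℝ ℝ) isOpen_Ioo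
        (isCompact_closedBall 0 R) ?_ hf.locallyIntegrable ?_
      · intro s u hs hu
        by_contra hne
        have h1 := ψ_supp _ hne
        rw [norm_smul, norm_inv, Real.norm_of_nonneg hs.1.le, inv_mul_lt_iff₀ hs.1, mul_one] at h1
        exact hu (by simpa using (h1.trans hs.2).le)
      · have : ContDiffOn ℝ (⊤ : ℕ∞)
            (fun q : ℝ × EuclideanSpace ℝ (Fin n) => q.1⁻¹ • q.2)
            (Set.Ioo 0 R ×ˢ Set.univ) :=
          (contDiffOn_fst.inv fun q hq => hq.1.1.ne').smul contDiffOn_snd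
        exact ψ_smooth.comp_contDiffOn this
    have hx₀ : (r x₀, x₀) ∈ Set.Ioo 0 R ×ˢ (Set.univ : Set (EuclideanSpace ℝ (Fin n))) :=
      ⟨⟨hpos x₀, by rw [hR]; linarith [hpos x₀]⟩, trivial⟩
    have hat := hconv.contDiffAt ((isOpen_Ioo.prod isOpen_univ).mem_nhds hx₀)
    have hcomp : ContDiffAt ℝ (⊤ : ℕ∞) (fun x =>
        (convolution f (K (r x)) (ContinuousLinearMap.mul ℝ ℝ) volume) x) x₀ :=
      ContDiffAt.comp x₀ (g := fun q : ℝ × EuclideanSpace ℝ (Fin n) =>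
        (convolution f (K q.1) (ContinuousLinearMap.mul ℝ ℝ) volume) q.2)
        (f := fun x => (r x, x)) hat (hr.contDiffAt.prodMk contDiffAt_id)
    have heq : (fun x => ∫ y, ψ y * f (x - r x • y)) = fun x =>
        ((r x ^ Module.finrank ℝ (EuclideanSpace ℝ (Fin n)))⁻¹) *
          (convolution f (K (r x)) (ContinuousLinearMap.mul ℝ ℝ) volume) x := by
      funext x
      have h := Measure.integral_comp_smul volume
        (fun u => f (x - u) * K (r x) u) (r x)
      rw [abs_of_nonneg (by have := hpos x; positivity), smul_eq_mul] at h
      rw [convolution_mul_swap, ← h]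
      refine integral_congr_ae (Eventually.of_forall fun y => ?_)
      simp [K, smul_smul, inv_mul_cancel₀ (hpos x).ne', mul_comm]
    rw [heq]
    exact ((hr.contDiffAt.pow _).inv (pow_ne_zero _ (hpos x₀).ne')).mul hcomp
  · intro x c e h
    have h1 : (∫ y, ψ y * f (x - r x • y)) - c = ∫ y, ψ y * (f (x - r x • y) - c) := by
      simp_rw [mul_sub]
      rw [integral_sub (hint x) (ψ_integrable.mul_const c), integral_mul_const, ψ_int, one_mul]
    rw [h1]
    have h2 : ‖∫ y, ψ y * (f (x - r x • y) - c)‖ ≤ ∫ y, ψ y * e := by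
      refine norm_integral_le_of_norm_le (ψ_integrable.mul_const e)
        (Eventually.of_forall fun y => ?_)
      rw [norm_mul, Real.norm_of_nonneg (ψ_nonneg y)]
      by_cases hy : ψ y = 0
      · simp [hy]
      · have := ψ_supp y hy
        refine mul_le_mul_of_nonneg_left (h _ ?_) (ψ_nonneg y)
        rw [dist_eq_norm, sub_sub_cancel_left, norm_neg, norm_smul,
          Real.norm_of_nonneg (hpos x).le]
        exact mul_le_of_le_one_right (hpos x).le this.le
    rwa [integral_mul_const, ψ_int, one_mul] at h2
  · intro K hK hr1
    refine LipschitzWith.of_dist_le_mul fun x x' => ?_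
    rw [dist_eq_norm, ← integral_sub (hint x) (hint x')]
    have h2 : ‖∫ y, (ψ y * f (x - r x • y) - ψ y * f (x' - r x' • y))‖ ≤
        ∫ y, ψ y * (2 * K * dist x x') := by
      refine norm_integral_le_of_norm_le (ψ_integrable.mul_const _)
        (Eventually.of_forall fun y => ?_)
      rw [← mul_sub, norm_mul, Real.norm_of_nonneg (ψ_nonneg y)]
      by_cases hy : ψ y = 0
      · simp [hy]
      · have hy1 := ψ_supp y hy
        refine mul_le_mul_of_nonneg_left ?_ (ψ_nonneg y)
        rw [← dist_eq_norm]
        refine (hK.dist_le_mul _ _).trans ?_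
        have h3 : dist (x - r x • y) (x' - r x' • y) ≤ 2 * dist x x' := by
          have h4 : dist (r x • y) (r x' • y) ≤ dist x x' := by
            rw [dist_eq_norm, ← sub_smul, norm_smul]
            have h5 := hr1.dist_le_mul x x'
            rw [dist_eq_norm, NNReal.coe_one, one_mul] at h5
            calc _ ≤ dist x x' * 1 := by gcongr
              _ = _ := mul_one _
          have := dist_sub_sub_le x (r x • y) x' (r x' • y)
          linarith
        calc (K : ℝ) * _ ≤ K * (2 * dist x x') := by gcongr
          _ = _ := by ring
    rw [integral_mul_const, ψ_int, one_mul] at h2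
    simpa using h2

/-- The adjoint as a real-linear continuous map between spaces of operators. -/
def adjointCLM (n k : ℕ) :
    (EuclideanSpace ℝ (Fin n) →L[ℝ] EuclideanSpace ℝ (Fin k)) →L[ℝ]
      (EuclideanSpace ℝ (Fin k) →L[ℝ] EuclideanSpace ℝ (Fin n)) :=
  LinearMap.toContinuousLinearMap
    { toFun := fun T => ContinuousLinearMap.adjoint T
      map_add' := fun S T => map_add _ S T
      map_smul' := fun c T => by simp }

@[simp]
theorem adjointCLM_apply {n k : ℕ}
    (T : EuclideanSpace ℝ (Fin n) →L[ℝ] EuclideanSpace ℝ (Fin k)) :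
    adjointCLM n k T = ContinuousLinearMap.adjoint T := rfl

theorem mem_range_adjoint_of_orthogonal_ker {n k : ℕ}
    (T : EuclideanSpace ℝ (Fin n) →L[ℝ] EuclideanSpace ℝ (Fin k)) {v : EuclideanSpace ℝ (Fin n)}
    (hv : ∀ w, T w = 0 → inner ℝ w v = 0) : ∃ l, ContinuousLinearMap.adjoint T l = v := by
  have h : v ∈ (T : EuclideanSpace ℝ (Fin n) →ₗ[ℝ] EuclideanSpace ℝ (Fin k)).kerᗮ :=
    (Submodule.mem_orthogonal _ _).2 fun w hw => hv w (by simpa using hw)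
  rw [ContinuousLinearMap.orthogonal_ker,
    (Submodule.closed_of_finiteDimensional _).submodule_topologicalClosure_eq] at h
  simpa using h

theorem metricProj_nonempty_of_eventually_closed {n : ℕ} {M : Set (EuclideanSpace ℝ (Fin n))}
    {x₀ : EuclideanSpace ℝ (Fin n)} (hx₀ : x₀ ∈ M) {ρ : ℝ} (hρ : 0 < ρ)
    (hcl : IsClosed (M ∩ closedBall x₀ ρ)) :
    ∀ᶠ x in 𝓝 x₀, (metricProj M x).Nonempty := by
  have hcomp : IsCompact (M ∩ closedBall x₀ ρ) :=
    (isCompact_closedBall x₀ ρ).of_isClosed_subset hcl Set.inter_subset_right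
  have hx₀' : x₀ ∈ M ∩ closedBall x₀ ρ := ⟨hx₀, mem_closedBall_self hρ.le⟩
  filter_upwards [ball_mem_nhds x₀ (half_pos hρ)] with x hx
  obtain ⟨y, hy, hyd⟩ := hcomp.exists_infDist_eq_dist ⟨x₀, hx₀'⟩ x
  refine ⟨y, hy.1, le_antisymm ?_ (infDist_le_dist_of_mem hy.1)⟩
  refine (le_infDist ⟨x₀, hx₀⟩).2 fun z hz => ?_
  rw [← hyd]
  by_cases hzb : z ∈ closedBall x₀ ρ
  · exact infDist_le_dist_of_mem ⟨hz, hzb⟩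
  · refine (infDist_le_dist_of_mem hx₀').trans ?_
    have h1 : dist z x₀ ≤ dist x z + dist x x₀ := by
      rw [dist_comm x z]; exact dist_triangle _ _ _
    have h2 : ρ < dist z x₀ := by simpa using hzb
    rw [mem_ball] at hx
    linarith

theorem IsCpManifold.exists_isClosed_inter {n d : ℕ} {q : ℕ∞}
    {M : Set (EuclideanSpace ℝ (Fin n))} (hM : IsCpManifold n q d M)
    {x₀ : EuclideanSpace ℝ (Fin n)} (hx₀ : x₀ ∈ M) :
    ∃ ρ > 0, IsClosed (M ∩ closedBall x₀ ρ) := by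
  obtain ⟨U, F, hU, hxU, hF, hMU, -⟩ := hM x₀ hx₀
  obtain ⟨ρ, hρ, hball⟩ := nhds_basis_closedBall.mem_iff.1 (hU.mem_nhds hxU)
  refine ⟨ρ, hρ, ?_⟩
  have : M ∩ closedBall x₀ ρ = closedBall x₀ ρ ∩ F ⁻¹' {0} := by
    ext y
    constructor
    · rintro ⟨h1, h2⟩
      have : y ∈ U ∩ F ⁻¹' {0} := hMU ▸ ⟨h1, hball h2⟩
      exact ⟨h2, this.2⟩
    · rintro ⟨h1, h2⟩
      have : y ∈ M ∩ U := hMU ▸ ⟨hball h1, h2⟩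
      exact ⟨this.1, h1⟩
  rw [this]
  exact (hF.continuousOn.mono hball).preimage_isClosed_of_isClosed isClosed_closedBall
    isClosed_singleton

theorem IsCpManifold.eventually_metricProj_nonempty {n d : ℕ} {q : ℕ∞}
    {M : Set (EuclideanSpace ℝ (Fin n))} (hM : IsCpManifold n q d M)
    {x₀ : EuclideanSpace ℝ (Fin n)} (hx₀ : x₀ ∈ M) :
    ∀ᶠ x in 𝓝 x₀, (metricProj M x).Nonempty := by
  obtain ⟨ρ, hρ, hcl⟩ := hM.exists_isClosed_inter hx₀
  exact metricProj_nonempty_of_eventually_closed hx₀ hρ hcl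

/-- A nearest point satisfies the Lagrange condition. -/
theorem exists_adjoint_eq_sub_of_mem_metricProj {n k : ℕ} {M U : Set (EuclideanSpace ℝ (Fin n))}
    {F : EuclideanSpace ℝ (Fin n) → EuclideanSpace ℝ (Fin k)} (hU : IsOpen U)
    (hMU : M ∩ U = U ∩ F ⁻¹' {0}) {x y : EuclideanSpace ℝ (Fin n)} (hy : y ∈ metricProj M x)
    (hyU : y ∈ U) {F' : EuclideanSpace ℝ (Fin n) →L[ℝ] EuclideanSpace ℝ (Fin k)}
    (hF : HasStrictFDerivAt F F' y) (hsurj : Function.Surjective F') :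
    ∃ l, ContinuousLinearMap.adjoint F' l = x - y := by
  have hFy : F y = 0 := by
    have : y ∈ U ∩ F ⁻¹' {0} := hMU ▸ ⟨hy.1, hyU⟩
    exact this.2
  have hmin : IsLocalExtrOn (fun z => ‖x - z‖ ^ 2) {z | F z = F y} y := by
    left
    have : ∀ᶠ z in 𝓝[{z | F z = F y}] y, z ∈ U :=
      mem_nhdsWithin_of_mem_nhds (hU.mem_nhds hyU)
    filter_upwards [this, self_mem_nhdsWithin] with z hzU hz
    have hzM : z ∈ M ∩ U := hMU ▸ ⟨hzU, by simpa [hFy] using hz⟩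
    have h1 : dist x y ≤ dist x z := hy.2.trans_le (infDist_le_dist_of_mem hzM.1)
    rw [dist_eq_norm, dist_eq_norm] at h1
    show ‖x - y‖ ^ 2 ≤ ‖x - z‖ ^ 2
    gcongr
  have hφ : HasStrictFDerivAt (fun z => ‖x - z‖ ^ 2)
      (2 • (innerSL ℝ (x - y)).comp (-ContinuousLinearMap.id ℝ _)) y :=
    (hasStrictFDerivAt_norm_sq (x - y)).comp y ((hasStrictFDerivAt_id y).const_sub x)
  obtain ⟨Λ, Λ₀, hne, hΛ⟩ := hmin.exists_linear_map_of_hasStrictFDerivAt hF hφ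
  have hΛ₀ : Λ₀ ≠ 0 := by
    rintro rfl
    apply hne
    have : Λ = 0 := by
      ext1 z
      obtain ⟨w, rfl⟩ := hsurj z
      simpa using hΛ w
    simp [this]
  refine mem_range_adjoint_of_orthogonal_ker F' fun w hw => ?_
  have := hΛ w
  simp [hw, hΛ₀] at this
  rw [real_inner_comm, inner_sub_left]
  linarith

theorem IsCpManifold.exists_local_projection {n d p : ℕ} (hp : 1 ≤ p)
    {M : Set (EuclideanSpace ℝ (Fin n))} (hM : IsCpManifold n ((p : ℕ∞) + 1) d M)
    {x₀ : EuclideanSpace ℝ (Fin n)} (hx₀ : x₀ ∈ M) :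
    ∃ P : EuclideanSpace ℝ (Fin n) → EuclideanSpace ℝ (Fin n),
      ContDiffAt ℝ p P x₀ ∧ (∀ᶠ x in 𝓝 x₀, metricProj M x = {P x}) ∧
      ∀ v ∈ normalSp n M x₀, ∀ᶠ t : ℝ in 𝓝 0, P (x₀ + t • v) = x₀ := by
  obtain ⟨k, U, F, hU, hxU, hF, hMU, hsurj⟩ : ∃ (k : ℕ) (U : Set (EuclideanSpace ℝ (Fin n)))
      (F : EuclideanSpace ℝ (Fin n) → EuclideanSpace ℝ (Fin k)), IsOpen U ∧ x₀ ∈ U ∧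
      ContDiffOn ℝ (((p : ℕ∞) + 1 : ℕ∞) : WithTop ℕ∞) F U ∧ M ∩ U = U ∩ F ⁻¹' {0} ∧
      Function.Surjective (fderiv ℝ F x₀) := ⟨n - d, hM x₀ hx₀⟩
  have hp0 : (p : WithTop ℕ∞) ≠ 0 := by
    have : p ≠ 0 := by lia
    exact_mod_cast this
  have hcast : (((p : ℕ∞) + 1 : ℕ∞) : WithTop ℕ∞) = (p : WithTop ℕ∞) + 1 := by
    norm_cast
  rw [hcast] at hF
  have hFx₀ : F x₀ = 0 := by
    have : x₀ ∈ U ∩ F ⁻¹' {0} := hMU ▸ ⟨hx₀, hxU⟩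
    exact this.2
  have hFat : ∀ y ∈ U, ContDiffAt ℝ ((p : WithTop ℕ∞) + 1) F y :=
    fun y hy => hF.contDiffAt (hU.mem_nhds hy)
  have hFstrict : ∀ y ∈ U, HasStrictFDerivAt F (fderiv ℝ F y) y :=
    fun y hy => (hFat y hy).hasStrictFDerivAt (by simp)
  let B : EuclideanSpace ℝ (Fin n) → (EuclideanSpace ℝ (Fin k) →L[ℝ] EuclideanSpace ℝ (Fin n)) :=
    fun y => adjointCLM n k (fderiv ℝ F y)
  have hB : ContDiffAt ℝ p B x₀ :=
    (adjointCLM n k).contDiff.contDiffAt.comp x₀ ((hFat x₀ hxU).fderiv_right le_rfl)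
  let Ψ : EuclideanSpace ℝ (Fin n) × EuclideanSpace ℝ (Fin k) →
      EuclideanSpace ℝ (Fin n) × EuclideanSpace ℝ (Fin k) := fun q => (q.1 + B q.1 q.2, F q.1)
  set q₀ : EuclideanSpace ℝ (Fin n) × EuclideanSpace ℝ (Fin k) := (x₀, 0) with hq₀
  have hBq : ContDiffAt ℝ p (fun q : EuclideanSpace ℝ (Fin n) × EuclideanSpace ℝ (Fin k) =>
      B q.1) q₀ := ContDiffAt.comp q₀ (g := B) hB contDiffAt_fst
  have hΨ : ContDiffAt ℝ p Ψ q₀ := by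
    refine (contDiffAt_fst.add (hBq.clm_apply contDiffAt_snd)).prodMk ?_
    exact ContDiffAt.comp q₀ (g := F) ((hFat x₀ hxU).of_le (by simp)) contDiffAt_fst
  have hΨ₀ : Ψ q₀ = q₀ := by simp [Ψ, hq₀, hFx₀]
  set A := fderiv ℝ F x₀ with hA
  let D : EuclideanSpace ℝ (Fin n) × EuclideanSpace ℝ (Fin k) →L[ℝ]
      EuclideanSpace ℝ (Fin n) × EuclideanSpace ℝ (Fin k) :=
    (ContinuousLinearMap.fst ℝ _ _ +
      (ContinuousLinearMap.adjoint A).comp (ContinuousLinearMap.snd ℝ _ _)).prod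
      (A.comp (ContinuousLinearMap.fst ℝ _ _))
  have hD : HasFDerivAt Ψ D q₀ := by
    refine HasFDerivAt.prodMk ?_ ?_
    · have h1 := (hBq.differentiableAt hp0).hasFDerivAt.clm_apply (hasFDerivAt_snd (p := q₀))
      have h2 := (hasFDerivAt_fst (p := q₀) (𝕜 := ℝ)).add h1
      refine h2.congr_fderiv ?_
      ext w <;> simp [hq₀, B, hA]
    · exact HasFDerivAt.comp q₀ (g := F) (hFstrict x₀ hxU).hasFDerivAt hasFDerivAt_fst
  have hadj_inj : ∀ l, ContinuousLinearMap.adjoint A l = 0 → l = 0 := by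
    intro l hl
    obtain ⟨w, rfl⟩ := hsurj l
    have : inner ℝ (A w) (A w) = 0 := by
      rw [← ContinuousLinearMap.adjoint_inner_right, hl, inner_zero_right]
    exact inner_self_eq_zero.1 this
  have hDinj : Function.Injective D := by
    rw [injective_iff_map_eq_zero]
    rintro ⟨h, μ⟩ hq
    have h1 : h + ContinuousLinearMap.adjoint A μ = 0 := congrArg Prod.fst hq
    have h2 : A h = 0 := congrArg Prod.snd hq
    have h3 : ContinuousLinearMap.adjoint A μ = 0 := by
      have h4 : inner ℝ h (ContinuousLinearMap.adjoint A μ) = 0 := by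
        rw [ContinuousLinearMap.adjoint_inner_right, h2, inner_zero_left]
      rw [eq_neg_of_add_eq_zero_left h1, inner_neg_left, neg_eq_zero] at h4
      exact inner_self_eq_zero.1 h4
    rw [h3, add_zero] at h1
    rw [h1, hadj_inj μ h3]; rfl
  let De : (EuclideanSpace ℝ (Fin n) × EuclideanSpace ℝ (Fin k)) ≃L[ℝ]
      EuclideanSpace ℝ (Fin n) × EuclideanSpace ℝ (Fin k) :=
    (LinearEquiv.ofInjectiveEndo (D : _ →ₗ[ℝ] _) hDinj).toContinuousLinearEquiv
  have hDe : (De : _ →L[ℝ] _) = D := by ext <;> rfl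
  have hD' : HasFDerivAt Ψ (De : _ →L[ℝ] _) q₀ := hDe ▸ hD
  have hstr : HasStrictFDerivAt Ψ (De : _ →L[ℝ] _) q₀ := hΨ.hasStrictFDerivAt' hD' hp0
  let ι := hΨ.localInverse hD' hp0
  have hι : ContDiffAt ℝ p ι q₀ := by
    have := hΨ.to_localInverse hD' hp0
    rwa [hΨ₀] at this
  have hι₀ : ι q₀ = q₀ := by
    have := hstr.localInverse_apply_image
    rw [hΨ₀] at this
    exact this
  have hleft : ∀ᶠ q in 𝓝 q₀, ι (Ψ q) = q := hstr.eventually_left_inverse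
  have hright : ∀ᶠ q in 𝓝 q₀, Ψ (ι q) = q := by
    have := hstr.eventually_right_inverse
    rw [hΨ₀] at this
    exact this
  have hιder : HasFDerivAt ι (De.symm : _ →L[ℝ] _) q₀ := by
    have := hstr.to_localInverse.hasFDerivAt
    rw [hΨ₀] at this
    exact this
  let P : EuclideanSpace ℝ (Fin n) → EuclideanSpace ℝ (Fin n) := fun x => (ι (x, 0)).1
  have hP : ContDiffAt ℝ p P x₀ :=
    contDiffAt_fst.comp x₀ (ContDiffAt.comp x₀ (g := ι) hι (contDiffAt_id.prodMk contDiffAt_const))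
  have hP₀ : P x₀ = x₀ := congrArg Prod.fst hι₀
  have hPM : ∀ᶠ x in 𝓝 x₀, P x ∈ M := by
    have h1 : Tendsto (fun x : EuclideanSpace ℝ (Fin n) =>
        (x, (0 : EuclideanSpace ℝ (Fin k)))) (𝓝 x₀) (𝓝 q₀) :=
      Continuous.tendsto' (by fun_prop) _ _ rfl
    have h2 : Tendsto P (𝓝 x₀) (𝓝 x₀) := by
      have := hP.continuousAt.tendsto
      rwa [hP₀] at this
    filter_upwards [h1.eventually hright, h2.eventually (hU.mem_nhds hxU)] with x hx hxU
    have : P x ∈ M ∩ U := hMU ▸ ⟨hxU, congrArg Prod.snd hx⟩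
    exact this.1
  have hker : ∀ w, A w = 0 → w ∈ tangentSp n M x₀ := by
    intro w hw
    refine Submodule.subset_span ?_
    let γ : ℝ → EuclideanSpace ℝ (Fin n) := fun t => P (x₀ + t • w)
    have hγ₀ : γ 0 = x₀ := by simp [γ, hP₀]
    have hDew : De.symm (w, 0) = (w, 0) := by
      rw [ContinuousLinearEquiv.symm_apply_eq]
      show (w, 0) = D (w, 0)
      simp [D, hw]
    have hPd : HasFDerivAt P ((ContinuousLinearMap.fst ℝ _ _).comp
        ((De.symm : _ →L[ℝ] _).comp ((ContinuousLinearMap.id ℝ _).prod 0))) x₀ :=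
      hasFDerivAt_fst.comp x₀ (HasFDerivAt.comp x₀ (g := ι) hιder
        ((hasFDerivAt_id x₀).prodMk (hasFDerivAt_const 0 x₀)))
    have hline : HasFDerivAt (fun t : ℝ => x₀ + t • w)
        (ContinuousLinearMap.toSpanSingleton ℝ w) 0 :=
      ((ContinuousLinearMap.toSpanSingleton ℝ w).hasFDerivAt).const_add x₀
    have hγd := HasFDerivAt.comp (0 : ℝ) (g := P) (by simpa using hPd) hline
    have hT : Tendsto (fun t : ℝ => x₀ + t • w) (𝓝 0) (𝓝 x₀) :=
      Continuous.tendsto' (by fun_prop) _ _ (by simp)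
    set s : Set ℝ := {t | γ t ∈ M} with hs
    have hsn : s ∈ 𝓝 (0 : ℝ) := hT.eventually hPM
    have h1 := (hγd.hasFDerivWithinAt (s := s)).mapsTo_tangent_cone
    have h2 : (1 : ℝ) ∈ tangentConeAt ℝ s 0 := by
      rw [← Set.univ_inter s, tangentConeAt_inter_nhds hsn, tangentConeAt_univ]
      trivial
    have h3 := h1 h2
    have h4 : γ '' s ⊆ M := by
      rintro _ ⟨t, ht, rfl⟩
      exact ht
    have h5 := tangentConeAt_mono h4 h3
    simpa [hDew, hP₀] using h5
  refine ⟨P, hP, ?_, ?_⟩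
  · obtain ⟨K, hK, hanti⟩ := LinearMap.exists_antilipschitzWith
      (ContinuousLinearMap.adjoint A : EuclideanSpace ℝ (Fin k) →ₗ[ℝ] EuclideanSpace ℝ (Fin n))
      ((LinearMap.ker_eq_bot').2 hadj_inj)
    have hlow : ∀ l, ‖l‖ ≤ K * ‖ContinuousLinearMap.adjoint A l‖ := fun l => by
      have := hanti.le_mul_dist l 0
      simpa using this
    have hBnear : ∀ᶠ y in 𝓝 x₀, ∀ l, ‖l‖ ≤ 2 * K * ‖B y l‖ := by
      have h1 : ∀ᶠ y in 𝓝 x₀, dist (B y) (B x₀) < 1 / (2 * K) :=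
        hB.continuousAt.eventually (ball_mem_nhds _ (by positivity))
      filter_upwards [h1] with y hy l
      have h2 : ‖B x₀ l‖ ≤ ‖B y l‖ + 1 / (2 * K) * ‖l‖ := by
        have h3 : ‖(B y - B x₀) l‖ ≤ 1 / (2 * K) * ‖l‖ := by
          refine ((B y - B x₀).le_opNorm l).trans ?_
          rw [dist_eq_norm] at hy
          gcongr
        have h4 : ‖B x₀ l‖ ≤ ‖B y l‖ + ‖(B y - B x₀) l‖ := by
          have := norm_sub_le (B y l) ((B y - B x₀) l)
          simpa using this
        linarith
      have h5 := hlow l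
      have h6 : ‖ContinuousLinearMap.adjoint A l‖ = ‖B x₀ l‖ := rfl
      rw [h6] at h5
      have hK' : (0 : ℝ) < K := hK
      have h7 : (K : ℝ) * (1 / (2 * K) * ‖l‖) = ‖l‖ / 2 := by field_simp
      have h8 : (K : ℝ) * ‖B x₀ l‖ ≤ K * (‖B y l‖ + 1 / (2 * K) * ‖l‖) := by gcongr
      rw [mul_add, h7] at h8
      linarith
    have hgood : ∀ᶠ y in 𝓝 x₀, y ∈ U ∧ ∀ l, ‖l‖ ≤ 2 * K * ‖B y l‖ :=
      (hU.eventually_mem hxU).and hBnear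
    obtain ⟨ρ, hρ, hρgood⟩ := Metric.eventually_nhds_iff.1 hgood
    obtain ⟨σ, hσ, hσleft⟩ := Metric.eventually_nhds_iff.1 hleft
    have hne := (show IsCpManifold n ((p : ℕ∞) + 1) d M from hM).eventually_metricProj_nonempty hx₀
    have hτ : 0 < min (ρ / 2) (min (σ / 2) (σ / (2 * K + 1))) := by positivity
    filter_upwards [hne, ball_mem_nhds x₀ hτ] with x hx hxb
    have huniq : ∀ y ∈ metricProj M x, y = P x := by
      intro y hy
      rw [mem_ball] at hxb
      have hd : dist x y ≤ dist x x₀ := hy.2.trans_le (infDist_le_dist_of_mem hx₀)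
      have hyx₀ : dist y x₀ ≤ 2 * dist x x₀ := by
        have := dist_triangle y x x₀
        rw [dist_comm y x] at this
        linarith
      have hb1 : dist x x₀ < ρ / 2 := lt_of_lt_of_le hxb (min_le_left _ _)
      have hb2 : dist x x₀ < σ / 2 :=
        lt_of_lt_of_le hxb ((min_le_right _ _).trans (min_le_left _ _))
      have hb3 : dist x x₀ < σ / (2 * K + 1) :=
        lt_of_lt_of_le hxb ((min_le_right _ _).trans (min_le_right _ _))
      obtain ⟨hyU, hylow⟩ := hρgood (y := y) (by linarith)
      have hinj : ∀ l, ContinuousLinearMap.adjoint (fderiv ℝ F y) l = 0 → l = 0 := by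
        intro l hl
        have := hylow l
        have h0 : B y l = 0 := hl
        simpa [h0] using this
      have hsy : Function.Surjective (fderiv ℝ F y) := by
        have h1 : (fderiv ℝ F y : EuclideanSpace ℝ (Fin n) →ₗ[ℝ]
            EuclideanSpace ℝ (Fin k)).range = ⊤ := by
          rw [← Submodule.orthogonal_eq_bot_iff, ContinuousLinearMap.orthogonal_range]
          exact (LinearMap.ker_eq_bot').2 hinj
        exact LinearMap.range_eq_top.1 h1
      obtain ⟨l, hl⟩ := exists_adjoint_eq_sub_of_mem_metricProj hU hMU hy hyU (hFstrict y hyU) hsy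
      have hln : ‖l‖ ≤ 2 * K * dist x x₀ := by
        refine (hylow l).trans ?_
        have h0 : B y l = x - y := hl
        rw [h0, ← dist_eq_norm]
        gcongr
      have hFy : F y = 0 := by
        have : y ∈ U ∩ F ⁻¹' {0} := hMU ▸ ⟨hy.1, hyU⟩
        exact this.2
      have hΨy : Ψ (y, l) = (x, 0) := by
        have h0 : B y l = x - y := hl
        simp [Ψ, h0, hFy]
      have hnear : dist (y, l) q₀ < σ := by
        rw [Prod.dist_eq, max_lt_iff]
        refine ⟨by simp only [hq₀]; linarith, ?_⟩
        simp only [hq₀, dist_zero_right]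
        have h1 : (2 * K + 1) * dist x x₀ < σ := by
          rwa [lt_div_iff₀' (by positivity)] at hb3
        have h2 : 0 ≤ dist x x₀ := dist_nonneg
        linarith
      have := hσleft hnear
      rw [hΨy] at this
      exact (congrArg Prod.fst this).symm
    obtain ⟨y, hy⟩ := hx
    ext z
    refine ⟨fun hz => huniq z hz, fun hz => ?_⟩
    rw [Set.mem_singleton_iff] at hz
    rw [hz, ← huniq y hy]
    exact hy
  · intro v hv
    obtain ⟨l, hl⟩ := mem_range_adjoint_of_orthogonal_ker A (v := v) fun w hw =>
      (Submodule.mem_orthogonal _ _).1 hv w (hker w hw)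
    have hT : Tendsto (fun t : ℝ => (x₀, t • l)) (𝓝 0) (𝓝 q₀) :=
      Continuous.tendsto' (by fun_prop) _ _ (by simp [hq₀])
    filter_upwards [hT.eventually hleft] with t ht
    have : Ψ (x₀, t • l) = (x₀ + t • v, 0) := by
      have h0 : B x₀ l = v := hl
      simp [Ψ, h0, hFx₀]
    rw [this] at ht
    exact congrArg Prod.fst ht

theorem abs_fderiv_interpolation_le {κ a b c d e r θ τ w N : ℝ} (hκ : 0 ≤ κ) (hN : 0 ≤ N)
    (hd : 0 ≤ d) (hr : 0 < r) (ha : |a| ≤ κ * N) (hb : |b| ≤ κ * (3 * N)) (hc : |c| ≤ 8 * d * N)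
    (he : |e| ≤ N) (hθ0 : 0 ≤ θ) (hθ1 : θ ≤ 1) (hw : |w| ≤ κ * d) (hτ : 1 ≤ d ^ 2 / r ^ 2 → τ = 0)
    (hq : |d ^ 2 / r ^ 2 * τ| ≤ 1) :
    |a + (τ * ((c * r ^ 2 - d ^ 2 * (2 * r * e)) / (r ^ 2) ^ 2) * w + θ * (b - a))| ≤
      13 * κ * N := by
  have h1 : |a + θ * (b - a)| ≤ 3 * κ * N := by
    have h2 : a + θ * (b - a) = (1 - θ) * a + θ * b := by ring
    have h3 : |(1 - θ) * a| ≤ (1 - θ) * (κ * N) := by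
      rw [abs_mul, abs_of_nonneg (sub_nonneg.2 hθ1)]
      exact mul_le_mul_of_nonneg_left ha (sub_nonneg.2 hθ1)
    have h4 : |θ * b| ≤ θ * (κ * (3 * N)) := by
      rw [abs_mul, abs_of_nonneg hθ0]
      exact mul_le_mul_of_nonneg_left hb hθ0
    rw [h2]
    have h5 := abs_add_le ((1 - θ) * a) (θ * b)
    have h6 : 0 ≤ κ * N := by positivity
    nlinarith
  have h2 : |τ * ((c * r ^ 2 - d ^ 2 * (2 * r * e)) / (r ^ 2) ^ 2) * w| ≤ 10 * κ * N := by
    rcases le_or_gt 1 (d ^ 2 / r ^ 2) with hq1 | hq1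
    · rw [hτ hq1]
      simp only [zero_mul, abs_zero]
      positivity
    · have hdr : d ≤ r := by
        rw [div_lt_one (by positivity)] at hq1
        exact (lt_of_pow_lt_pow_left₀ 2 hr.le hq1).le
      have h3 : |c * r ^ 2 - d ^ 2 * (2 * r * e)| ≤ 10 * d * r ^ 2 * N := by
        have h4 : |c * r ^ 2| ≤ 8 * d * N * r ^ 2 := by
          rw [abs_mul, abs_of_pos (by positivity : 0 < r ^ 2)]
          gcongr
        have h5 : |d ^ 2 * (2 * r * e)| ≤ 2 * d * r ^ 2 * N := by
          have : d ^ 2 * (2 * r * e) = (2 * d * r) * d * e := by ring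
          rw [this, abs_mul, abs_of_nonneg (by positivity)]
          calc 2 * d * r * d * |e| ≤ 2 * d * r * r * N := by gcongr
            _ = _ := by ring
        have := abs_sub (c * r ^ 2) (d ^ 2 * (2 * r * e))
        linarith
      rw [abs_mul, abs_mul, abs_div, abs_of_pos (by positivity : 0 < (r ^ 2) ^ 2)]
      have h6 : |d ^ 2 / r ^ 2 * τ| = d ^ 2 / r ^ 2 * |τ| := by
        rw [abs_mul, abs_of_nonneg (by positivity)]
      rw [h6] at hq
      calc |τ| * (|c * r ^ 2 - d ^ 2 * (2 * r * e)| / (r ^ 2) ^ 2) * |w|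
          ≤ |τ| * ((10 * d * r ^ 2 * N) / (r ^ 2) ^ 2) * (κ * d) := by gcongr
        _ = (d ^ 2 / r ^ 2 * |τ|) * (10 * κ * N) := by field_simp
        _ ≤ 1 * (10 * κ * N) := by gcongr
        _ = _ := one_mul _
  have h3 : a + (τ * ((c * r ^ 2 - d ^ 2 * (2 * r * e)) / (r ^ 2) ^ 2) * w + θ * (b - a)) =
    (a + θ * (b - a)) + τ * ((c * r ^ 2 - d ^ 2 * (2 * r * e)) / (r ^ 2) ^ 2) * w := by ring
  rw [h3]
  have := abs_add_le (a + θ * (b - a)) (τ * ((c * r ^ 2 - d ^ 2 * (2 * r * e)) / (r ^ 2) ^ 2) * w)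
  linarith

/-- Interpolating between `f` and `f ∘ P`, where `P` is the projection onto `M`, on an open
neighbourhood `O` of `M`. -/
theorem exists_contDiff_interpolation {n p : ℕ} (hp : 1 ≤ p)
    {M O : Set (EuclideanSpace ℝ (Fin n))}
    {P : EuclideanSpace ℝ (Fin n) → EuclideanSpace ℝ (Fin n)}
    {f : EuclideanSpace ℝ (Fin n) → ℝ} (hf : ContDiff ℝ p f) (hO : IsOpen O) (hMO : M ⊆ O)
    (hPM : ∀ x ∈ O, P x ∈ M) (hPfix : ∀ x ∈ M, P x = x) (hP : ∀ x ∈ O, ContDiffAt ℝ p P x)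
    (hP' : ∀ x ∈ O, ‖fderiv ℝ P x‖ ≤ 3)
    (hcl : ∀ x ∈ closure M, x ∉ O → ∀ᶠ x' in 𝓝 x, x' ∈ O → f (P x') = f x') :
    ∃ g : EuclideanSpace ℝ (Fin n) → ℝ, ContDiff ℝ p g ∧ (∀ x ∉ O, g =ᶠ[𝓝 x] f) ∧
      (∀ x ∈ M, ∀ᶠ x' in 𝓝 x, g x' = f (P x')) ∧
      (∀ x ∈ O, ∃ t, 0 ≤ t ∧ t ≤ 1 ∧ g x = f x + t * (f (P x) - f x)) ∧
      ∀ κ : NNReal, LipschitzWith κ f → LipschitzWith (13 * κ) g := by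
  classical
  obtain ⟨θ, hθ, hθ0, hθ1, ⟨a, ha, hθa⟩, hθz, hθ'z, hθ'⟩ := exists_contDiff_log_cutoff
  obtain ⟨r, hr, hr0, hrO, -, hrL⟩ := exists_contDiff_small hO (fun _ _ => True)
    (fun _ _ => ⟨1, one_pos, Eventually.of_forall fun _ _ _ _ => trivial⟩) (κ := 1) one_pos
  have hp1 : (1 : WithTop ℕ∞) ≤ p := by exact_mod_cast hp
  have hp0 : (p : WithTop ℕ∞) ≠ 0 := (zero_lt_one.trans_le hp1).ne'
  have hple : (p : WithTop ℕ∞) ≤ ((⊤ : ℕ∞) : WithTop ℕ∞) := by exact_mod_cast le_top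
  let q : EuclideanSpace ℝ (Fin n) → ℝ := fun x => ‖x - P x‖ ^ 2 / r x ^ 2
  let G : EuclideanSpace ℝ (Fin n) → ℝ := fun x => f x + θ (q x) * (f (P x) - f x)
  let g : EuclideanSpace ℝ (Fin n) → ℝ := fun x => if x ∈ O then G x else f x
  have hgO : ∀ x ∈ O, g x = G x := fun x hx => if_pos hx
  have hgO' : ∀ x ∈ O, g =ᶠ[𝓝 x] G := fun x hx => by
    filter_upwards [hO.mem_nhds hx] with y hy using hgO y hy
  have hqd : ∀ x ∈ O, ContDiffAt ℝ p q x := fun x hx =>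
    ((contDiffAt_id.sub (hP x hx)).norm_sq ℝ).div ((hr.contDiffAt.of_le hple).pow 2)
      (pow_ne_zero _ ((hrO x).1 hx).ne')
  have hfP : ∀ x ∈ O, ContDiffAt ℝ p (fun x => f (P x)) x := fun x hx =>
    hf.contDiffAt.comp x (hP x hx)
  have hG : ∀ x ∈ O, ContDiffAt ℝ p G x := fun x hx =>
    hf.contDiffAt.add (((hθ.contDiffAt.of_le hple).comp x (hqd x hx)).mul
      ((hfP x hx).sub hf.contDiffAt))
  have hout : ∀ x ∉ O, g =ᶠ[𝓝 x] f := by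
    intro x hx
    by_cases hxM : x ∈ closure M
    · filter_upwards [hcl x hxM hx] with y hy
      by_cases hyO : y ∈ O
      · simp [g, G, hy hyO]
      · exact if_neg hyO
    · obtain ⟨ρ, hρ, hball⟩ := Metric.isOpen_iff.1 isClosed_closure.isOpen_compl x hxM
      have hrx : r x = 0 := le_antisymm (not_lt.1 fun h => hx ((hrO x).2 h)) (hr0 x)
      have hrs : ∀ᶠ y in 𝓝 x, r y < ρ / 2 :=
        hr.continuous.continuousAt.eventually_lt continuousAt_const (by rw [hrx]; positivity)
      filter_upwards [hrs, ball_mem_nhds x (half_pos hρ)] with y hy hyb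
      by_cases hyO : y ∈ O
      · have h1 : ρ / 2 ≤ ‖y - P y‖ := by
          by_contra! h
          rw [← dist_eq_norm] at h
          rw [mem_ball] at hyb
          have h2 : P y ∈ ball x ρ := by
            rw [mem_ball]
            have := dist_triangle (P y) y x
            rw [dist_comm (P y) y] at this
            linarith
          exact hball h2 (subset_closure (hPM y hyO))
        have hry := (hrO y).1 hyO
        have h2 : 1 ≤ q y := by
          rw [one_le_div (by positivity)]
          gcongr
          linarith
        simp [g, G, hθz _ h2]
      · exact if_neg hyO
  have hgd : ContDiff ℝ p g := by
    rw [contDiff_iff_contDiffAt]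
    intro x
    by_cases hx : x ∈ O
    · exact (hG x hx).congr_of_eventuallyEq (hgO' x hx)
    · exact hf.contDiffAt.congr_of_eventuallyEq (hout x hx)
  refine ⟨g, hgd, hout, ?_, ?_, ?_⟩
  · intro x hx
    have hxO := hMO hx
    have h1 : ∀ᶠ y in 𝓝 x, |q y| < a :=
      (hqd x hxO).continuousAt.abs.eventually_lt continuousAt_const (by simp [q, hPfix x hx, ha])
    filter_upwards [h1, hO.mem_nhds hxO] with y hy hyO
    rw [hgO y hyO]
    simp [G, hθa _ hy]
  · exact fun x hx => ⟨θ (q x), hθ0 _, hθ1 _, hgO x hx⟩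
  · intro κ hκ
    refine lipschitzWith_of_nnnorm_fderiv_le (𝕜 := ℝ) (hgd.differentiable hp0) fun x => ?_
    have hfκ : ∀ y, ‖fderiv ℝ f y‖ ≤ κ := fun y => norm_fderiv_le_of_lipschitz ℝ hκ
    rw [← NNReal.coe_le_coe, coe_nnnorm]
    by_cases hx : x ∈ O
    · rw [(hgO' x hx).fderiv_eq]
      refine ContinuousLinearMap.opNorm_le_bound _ (by positivity) fun h => ?_
      have hrx := (hrO x).1 hx
      have hrd : HasFDerivAt r (fderiv ℝ r x) x := (hr.differentiable (by simp) x).hasFDerivAt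
      have hfd : ∀ y, HasFDerivAt f (fderiv ℝ f y) y :=
        fun y => (hf.differentiable hp0 y).hasFDerivAt
      have hPd : HasFDerivAt P (fderiv ℝ P x) x := ((hP x hx).differentiableAt hp0).hasFDerivAt
      have hsd := ((hasFDerivAt_id x).sub hPd).norm_sq
      have l1 := (hfd x).hasLineDerivAt h
      have l2 := ((hfd (P x)).comp x hPd).hasLineDerivAt h
      have l3 := hsd.hasLineDerivAt h
      have l4 := hrd.hasLineDerivAt h
      have lG := (((hG x hx).differentiableAt hp0).hasFDerivAt).hasLineDerivAt h
      unfold HasLineDerivAt at l1 l2 l3 l4 lG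
      have lq := l3.div (l4.pow 2) (by simpa using hrx.ne')
      have lθ := HasDerivAt.comp (0 : ℝ) (hθ.differentiable (by simp) _).hasDerivAt lq
      have l := l1.add (lθ.mul (l2.sub l1))
      have heq := lG.unique l
      have hkey := abs_fderiv_interpolation_le (κ := κ) (N := ‖h‖) (d := ‖x - P x‖) (r := r x)
        (a := fderiv ℝ f x h) (b := fderiv ℝ f (P x) (fderiv ℝ P x h))
        (c := 2 * inner ℝ (x - P x) (h - fderiv ℝ P x h)) (e := fderiv ℝ r x h) (θ := θ (q x))
        (τ := deriv θ (q x)) (w := f (P x) - f x) κ.2 (norm_nonneg _) (norm_nonneg _) hrx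
        ?_ ?_ ?_ ?_ (hθ0 _) (hθ1 _) ?_ (hθ'z _) (hθ' _)
      · rw [heq, Real.norm_eq_abs]
        refine (le_of_eq ?_).trans hkey
        simp [q, inner_sub_left, inner_sub_right]
      · exact ((fderiv ℝ f x).le_opNorm h).trans (by gcongr; exact hfκ x)
      · refine ((fderiv ℝ f (P x)).le_opNorm _).trans ?_
        gcongr
        · exact hfκ _
        · exact ((fderiv ℝ P x).le_opNorm h).trans (by gcongr; exact hP' x hx)
      · have h1 : ‖h - fderiv ℝ P x h‖ ≤ 4 * ‖h‖ := by
          have h2 : ‖fderiv ℝ P x h‖ ≤ 3 * ‖h‖ :=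
            ((fderiv ℝ P x).le_opNorm h).trans (by gcongr; exact hP' x hx)
          have := norm_sub_le h (fderiv ℝ P x h)
          linarith
        have h3 := abs_real_inner_le_norm (x - P x) (h - fderiv ℝ P x h)
        rw [abs_mul, abs_two]
        calc 2 * |inner ℝ (x - P x) (h - fderiv ℝ P x h)|
            ≤ 2 * (‖x - P x‖ * (4 * ‖h‖)) := by gcongr; exact h3.trans (by gcongr)
          _ = _ := by ring
      · refine ((fderiv ℝ r x).le_opNorm h).trans (mul_le_of_le_one_left (norm_nonneg _) ?_)
        exact norm_fderiv_le_of_lipschitz ℝ hrL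
      · have := hκ.dist_le_mul (P x) x
        rwa [dist_comm (P x) x, dist_eq_norm x, Real.dist_eq] at this
    · rw [(hout x hx).fderiv_eq]
      refine (hfκ x).trans ?_
      have : (0 : ℝ) ≤ κ := κ.2
      push_cast
      linarith

theorem metricProj_self {n : ℕ} {M : Set (EuclideanSpace ℝ (Fin n))}
    {x : EuclideanSpace ℝ (Fin n)} (hx : x ∈ M) : metricProj M x = {x} := by
  ext y
  simp only [metricProj, Set.mem_ofPred_eq, infDist_zero_of_mem hx, Set.mem_singleton_iff]
  constructor
  · rintro ⟨-, h⟩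
    exact (dist_eq_zero.1 h).symm
  · rintro rfl
    exact ⟨hx, dist_self _⟩

theorem dist_le_of_mem_metricProj {n : ℕ} {M : Set (EuclideanSpace ℝ (Fin n))}
    {x y z : EuclideanSpace ℝ (Fin n)} (hy : y ∈ metricProj M x) (hz : z ∈ closure M) :
    dist y z ≤ 2 * dist x z := by
  have h1 : dist x y ≤ dist x z := by
    rw [hy.2, ← infDist_closure]
    exact infDist_le_dist_of_mem hz
  have h2 := dist_triangle y x z
  rw [dist_comm y x] at h2
  linarith

/-- A global selection of the metric projection onto a manifold. -/
theorem IsCpManifold.exists_projection {n d p : ℕ} (hp : 1 ≤ p)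
    {M : Set (EuclideanSpace ℝ (Fin n))} (hM : IsCpManifold n ((p : ℕ∞) + 1) d M) :
    ∃ P : EuclideanSpace ℝ (Fin n) → EuclideanSpace ℝ (Fin n), ∀ x ∈ M,
      ContDiffAt ℝ p P x ∧ (∀ᶠ y in 𝓝 x, metricProj M y = {P y}) ∧ P x = x ∧
      ‖fderiv ℝ P x‖ ≤ 2 := by
  classical
  let P : EuclideanSpace ℝ (Fin n) → EuclideanSpace ℝ (Fin n) := fun x =>
    if h : (metricProj M x).Nonempty then h.choose else x
  have hP : ∀ x y, metricProj M x = {y} → P x = y := by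
    intro x y h
    have hne : (metricProj M x).Nonempty := h ▸ Set.singleton_nonempty y
    have h1 : P x ∈ metricProj M x := by
      simp only [P, dif_pos hne]
      exact hne.choose_spec
    rw [h] at h1
    exact h1
  refine ⟨P, fun x hx => ?_⟩
  obtain ⟨P', hP'd, hP', -⟩ := hM.exists_local_projection hp hx
  have heq : P =ᶠ[𝓝 x] P' := hP'.mono fun y hy => hP y _ hy
  have hd : ContDiffAt ℝ p P x := hP'd.congr_of_eventuallyEq heq
  have hx' : P x = x := hP x x (metricProj_self hx)
  have hproj : ∀ᶠ y in 𝓝 x, metricProj M y = {P y} := by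
    filter_upwards [hP', heq] with y h1 h2
    rw [h1, h2]
  refine ⟨hd, hproj, hx', ?_⟩
  have hp0 : (p : WithTop ℕ∞) ≠ 0 := by
    have : p ≠ 0 := by lia
    exact_mod_cast this
  refine (hd.differentiableAt hp0).hasFDerivAt.le_of_lip' zero_le_two ?_
  filter_upwards [hproj] with y hy
  have hm : P y ∈ metricProj M y := by rw [hy]; rfl
  have := dist_le_of_mem_metricProj hm (subset_closure hx)
  rw [dist_eq_norm, dist_eq_norm] at this
  rwa [hx']

/-- Near each point of `L`, `f` is constant along the fibres of the metric projection onto `L`. -/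
def FlatNear {n : ℕ} (f : EuclideanSpace ℝ (Fin n) → ℝ) (L : Set (EuclideanSpace ℝ (Fin n))) :
    Prop :=
  ∀ y ∈ L, ∀ᶠ x in 𝓝 y, ∀ z ∈ metricProj L x, f x = f z

theorem FlatNear.of_eventuallyEq {n : ℕ} {f g : EuclideanSpace ℝ (Fin n) → ℝ}
    {L : Set (EuclideanSpace ℝ (Fin n))} (hf : FlatNear f L) (h : ∀ x ∈ L, g =ᶠ[𝓝 x] f) :
    FlatNear g L := by
  intro y hy
  filter_upwards [hf y hy, h y hy] with x hx hgx z hz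
  rw [hgx, hx z hz, (h z hz.1).eq_of_nhds]

/-- Flattening a function near one more stratum. -/
theorem exists_flatNear_insert {n d p : ℕ} (hp : 1 ≤ p) {M : Set (EuclideanSpace ℝ (Fin n))}
    (hM : IsCpManifold n ((p : ℕ∞) + 1) d M) {S : Set (Set (EuclideanSpace ℝ (Fin n)))}
    (hS : IsClosed (⋃₀ S)) (hSM : Disjoint (⋃₀ S) M) (hfr : closure M \ M ⊆ ⋃₀ S)
    (hSn : ∀ L ∈ S, ∀ x ∈ L, ∀ᶠ y in 𝓝 x, (metricProj L y).Nonempty)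
    (hflat : ∀ L ∈ S, (L ∩ closure M).Nonempty → ∃ V U : Set (EuclideanSpace ℝ (Fin n)),
      IsOpen V ∧ IsOpen U ∧ L ⊆ V ∧ M ⊆ U ∧
      ∀ x ∈ V ∩ U, metricProj L x = ⋃ z ∈ metricProj M x, metricProj L z)
    (hSfin : S.Finite)
    {f δ : EuclideanSpace ℝ (Fin n) → ℝ} (hf : ContDiff ℝ p f) (hδ : Continuous δ)
    (hδ0 : ∀ x, 0 < δ x) (hfS : ∀ L ∈ S, FlatNear f L) {V₁ : Set (EuclideanSpace ℝ (Fin n))}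
    (hV₁ : IsOpen V₁) (hsupp : tsupport f ⊆ V₁) :
    ∃ g : EuclideanSpace ℝ (Fin n) → ℝ, ContDiff ℝ p g ∧ (∀ x, |f x - g x| < δ x) ∧
      tsupport g ⊆ V₁ ∧ (∀ κ : NNReal, LipschitzWith κ f → LipschitzWith (13 * κ) g) ∧
      (∀ L ∈ S, FlatNear g L) ∧ FlatNear g M := by
  have hp1 : (1 : WithTop ℕ∞) ≤ p := by exact_mod_cast hp
  obtain ⟨P, hP⟩ := hM.exists_projection hp
  obtain ⟨V', hV', hfV', hV'V₁⟩ := normal_exists_closure_subset (isClosed_tsupport f) hV₁ hsupp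
  have hVU : ∀ L, ∃ V U : Set (EuclideanSpace ℝ (Fin n)), L ∈ S → (L ∩ closure M).Nonempty →
      IsOpen V ∧ IsOpen U ∧ L ⊆ V ∧ M ⊆ U ∧
      ∀ x ∈ V ∩ U, metricProj L x = ⋃ z ∈ metricProj M x, metricProj L z := by
    intro L
    by_cases h : L ∈ S ∧ (L ∩ closure M).Nonempty
    · obtain ⟨V, U, hVU⟩ := hflat L h.1 h.2
      exact ⟨V, U, fun _ _ => hVU⟩
    · exact ⟨∅, ∅, fun h1 h2 => absurd ⟨h1, h2⟩ h⟩
  choose V U hVU using hVU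
  let W : Set (EuclideanSpace ℝ (Fin n)) := {x | ContDiffAt ℝ p P x ∧ metricProj M x = {P x} ∧
    ‖fderiv ℝ P x‖ < 3 ∧ |f (P x) - f x| < δ x ∧ x ∉ ⋃₀ S ∧
    (∀ L ∈ S, (L ∩ closure M).Nonempty → x ∈ U L) ∧ (x ∈ V' ∨ f (P x) = 0)}
  have hMW : M ⊆ interior W := by
    intro x hx
    obtain ⟨h1, h2, h3, h4⟩ := hP x hx
    have hc : ContinuousAt (fun y => f (P y)) x :=
      hf.continuous.continuousAt.comp h1.continuousAt
    have e3 : ∀ᶠ y in 𝓝 x, ‖fderiv ℝ P y‖ < 3 := by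
      have : ContinuousAt (fun y => ‖fderiv ℝ P y‖) x :=
        (h1.fderiv_right (m := 0) (by simpa using hp1)).continuousAt.norm
      exact this.eventually_lt continuousAt_const (by linarith)
    have e4 : ∀ᶠ y in 𝓝 x, |f (P y) - f y| < δ y :=
      (hc.sub hf.continuous.continuousAt).abs.eventually_lt hδ.continuousAt
        (by simp [h3, hδ0 x])
    have e5 : ∀ᶠ y in 𝓝 x, y ∉ ⋃₀ S :=
      hS.isOpen_compl.eventually_mem fun h => Set.disjoint_left.1 hSM h hx
    have e6 : ∀ᶠ y in 𝓝 x, ∀ L ∈ S, (L ∩ closure M).Nonempty → y ∈ U L := by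
      rw [hSfin.eventually_all]
      intro L hL
      by_cases hLM : (L ∩ closure M).Nonempty
      · obtain ⟨-, hU, -, hMU, -⟩ := hVU L hL hLM
        filter_upwards [hU.mem_nhds (hMU hx)] with y hy _ using hy
      · exact Eventually.of_forall fun y h => absurd h hLM
    have e7 : ∀ᶠ y in 𝓝 x, y ∈ V' ∨ f (P y) = 0 := by
      by_cases hxV : x ∈ tsupport f
      · filter_upwards [hV'.mem_nhds (hfV' hxV)] with y hy using Or.inl hy
      · have hPx : Tendsto P (𝓝 x) (𝓝 x) := by
          have := h1.continuousAt.tendsto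
          rwa [h3] at this
        filter_upwards [hPx.eventually ((isClosed_tsupport f).isOpen_compl.mem_nhds hxV)]
          with y hy
        exact Or.inr (image_eq_zero_of_notMem_tsupport hy)
    rw [mem_interior_iff_mem_nhds]
    filter_upwards [h1.eventually (by simp), h2, e3, e4, e5, e6, e7] with y a1 a2 a3 a4 a5 a6 a7
    exact ⟨a1, a2, a3, a4, a5, a6, a7⟩
  have hWP : ∀ x ∈ interior W, P x ∈ metricProj M x := fun x hx => by
    rw [(interior_subset hx).2.1]; rfl
  have hcl : ∀ x ∈ closure M, x ∉ interior W →
      ∀ᶠ x' in 𝓝 x, x' ∈ interior W → f (P x') = f x' := by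
    intro x hx hxW
    obtain ⟨L, hL, hxL⟩ := hfr ⟨hx, fun h => hxW (hMW h)⟩
    obtain ⟨hV, hU, hLV, hMU, hproj⟩ := hVU L hL ⟨x, hxL, hx⟩
    obtain ⟨η, hη, hball⟩ := Metric.eventually_nhds_iff.1 (hfS L hL x hxL)
    filter_upwards [hV.mem_nhds (hLV hxL), hSn L hL x hxL, ball_mem_nhds x (half_pos hη)]
      with y hyV hyne hyη hyW
    rw [mem_ball] at hyη
    obtain ⟨z, hz⟩ := hyne
    have hyP := (interior_subset hyW).2.1
    have h1 : z ∈ metricProj L (P y) := by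
      have h2 := hproj y ⟨hyV, (interior_subset hyW).2.2.2.2.2.1 L hL ⟨x, hxL, hx⟩⟩
      rw [hyP, Set.biUnion_singleton] at h2
      rwa [← h2]
    have h3 := dist_le_of_mem_metricProj (hWP y hyW) hx
    rw [hball (y := P y) (by linarith) z h1, hball (y := y) (by linarith) z hz]
  obtain ⟨g, hg, hgout, hgM, hgO, hgL⟩ := exists_contDiff_interpolation hp hf isOpen_interior hMW
    (fun x hx => (hWP x hx).1) (fun x hx => (hP x hx).2.2.1)
    (fun x hx => (interior_subset hx).1) (fun x hx => (interior_subset hx).2.2.1.le) hcl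
  refine ⟨g, hg, ?_, ?_, hgL, ?_, ?_⟩
  · intro x
    by_cases hx : x ∈ interior W
    · obtain ⟨t, ht0, ht1, hgx⟩ := hgO x hx
      have h1 : f x - g x = -(t * (f (P x) - f x)) := by rw [hgx]; ring
      rw [h1, abs_neg, abs_mul, abs_of_nonneg ht0]
      exact (mul_le_of_le_one_left (abs_nonneg _) ht1).trans_lt (interior_subset hx).2.2.2.1
    · rw [(hgout x hx).eq_of_nhds]
      simpa using hδ0 x
  · refine Set.Subset.trans (closure_mono fun x hx => ?_) hV'V₁
    by_contra hxV'
    have hfx : f x = 0 := image_eq_zero_of_notMem_tsupport fun h => hxV' (hfV' h)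
    apply hx
    by_cases hxW : x ∈ interior W
    · obtain ⟨t, -, -, hgx⟩ := hgO x hxW
      rw [hgx, hfx, (interior_subset hxW).2.2.2.2.2.2.resolve_left hxV']
      simp
    · rw [(hgout x hxW).eq_of_nhds, hfx]
  · intro L hL
    exact (hfS L hL).of_eventuallyEq fun x hx => hgout x fun h =>
      (interior_subset h).2.2.2.2.1 ⟨L, hL, hx⟩
  · intro x hx
    filter_upwards [hgM x hx, (hP x hx).2.1] with y h1 h2 z hz
    have hzM := hz.1
    rw [h2] at hz
    rw [h1, (hgM z hzM).self_of_nhds, (hP z hzM).2.2.1, ← hz]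

theorem exists_near_optimal_lipschitz_const {E : Type*} [PseudoMetricSpace E] {f : E → ℝ}
    {x y : E} (hxy : f x ≠ f y) :
    ∃ κ₀ : NNReal, 0 < κ₀ ∧
      ∀ κ : NNReal, LipschitzWith κ f → LipschitzWith κ₀ f ∧ 8 * κ₀ ≤ 13 * κ := by
  rcases Set.eq_empty_or_nonempty {κ : NNReal | LipschitzWith κ f} with h | h
  · exact ⟨1, one_pos, fun κ hκ => (Set.eq_empty_iff_forall_notMem.1 h κ hκ).elim⟩
  · have hpos : ∀ κ : NNReal, LipschitzWith κ f → nndist (f x) (f y) / nndist x y ≤ κ := by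
      intro κ hκ
      rw [← NNReal.coe_le_coe]
      push_cast
      exact div_le_of_le_mul₀ dist_nonneg κ.2 (hκ.dist_le_mul x y)
    have hd : 0 < nndist (f x) (f y) / nndist x y := by
      obtain ⟨κ, hκ⟩ := h
      have h1 : 0 < nndist (f x) (f y) := pos_iff_ne_zero.2 fun h => hxy (nndist_eq_zero.1 h)
      have h2 : nndist (f x) (f y) ≤ κ * nndist x y := by
        exact_mod_cast hκ.dist_le_mul x y
      have h3 : nndist x y ≠ 0 := by
        intro h3
        rw [h3, mul_zero] at h2
        exact absurd h2 (not_le.2 h1)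
      exact div_pos h1 (pos_iff_ne_zero.2 h3)
    set I := sInf {κ : NNReal | LipschitzWith κ f} with hI
    have hI0 : 0 < I := hd.trans_le (le_csInf h hpos)
    have hlt : I < 13 / 8 * I := by
      rw [← NNReal.coe_lt_coe]
      push_cast
      have : (0 : ℝ) < I := hI0
      linarith
    obtain ⟨κ₀, hκ₀, hκ₀I⟩ := exists_lt_of_csInf_lt h hlt
    refine ⟨κ₀, hd.trans_le (hpos κ₀ hκ₀), fun κ hκ => ⟨hκ₀, ?_⟩⟩
    have h1 : I ≤ κ := csInf_le (OrderBot.bddBelow _) hκ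
    rw [← NNReal.coe_le_coe] at h1 ⊢
    rw [← NNReal.coe_lt_coe] at hκ₀I
    push_cast at hκ₀I ⊢
    linarith

theorem exists_contDiff_approx {n : ℕ} {f ε : EuclideanSpace ℝ (Fin n) → ℝ}
    (hf : Continuous f) (hε : Continuous ε) (hε0 : ∀ x, 0 < ε x)
    {V₁ : Set (EuclideanSpace ℝ (Fin n))} (hV₁ : IsOpen V₁) (hsupp : Function.support f ⊆ V₁) :
    ∃ g : EuclideanSpace ℝ (Fin n) → ℝ, ContDiff ℝ (⊤ : ℕ∞) g ∧ (∀ x, |f x - g x| < ε x) ∧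
      tsupport g ⊆ V₁ ∧ ∀ κ : NNReal, LipschitzWith κ f → LipschitzWith (13 * κ) g := by
  by_cases hconst : ∀ x y, f x = f y
  · have hfc : f = fun _ => f 0 := funext fun x => hconst x 0
    refine ⟨f, hfc ▸ contDiff_const, fun x => by simpa using hε0 x, ?_, fun κ hκ => hκ.weaken ?_⟩
    · by_cases h0 : f 0 = 0
      · have : f = 0 := by rw [hfc, h0]; rfl
        rw [tsupport_eq_empty_iff.2 this]
        exact Set.empty_subset _
      · have : V₁ = Set.univ := Set.eq_univ_of_univ_subset fun x _ =>
          hsupp (by rw [Function.mem_support, hconst x 0]; exact h0)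
        rw [this]
        exact Set.subset_univ _
    · exact le_mul_of_one_le_left zero_le (by norm_num)
  · push Not at hconst
    obtain ⟨x₁, x₂, hx₁₂⟩ := hconst
    obtain ⟨κ₀, hκ₀, hκ₀f⟩ := exists_near_optimal_lipschitz_const hx₁₂
    obtain ⟨δ, hδ, -, hδ0, hδε, hδL⟩ := exists_contDiff_small (E := EuclideanSpace ℝ (Fin n))
      isOpen_univ (fun x s => s < ε x / 2) (fun x _ => ⟨ε x / 4, by have := hε0 x; positivity, by
        have h1 : ∀ᶠ y in 𝓝 x, ε x / 2 < ε y :=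
          continuousAt_const.eventually_lt hε.continuousAt (by linarith [hε0 x])
        filter_upwards [h1] with y hy s _ hs
        linarith⟩) hκ₀
    replace hδ0 : ∀ x, 0 < δ x := fun x => (hδ0 x).1 trivial
    replace hδε : ∀ x, δ x < ε x / 2 := fun x => hδε x trivial
    let F : EuclideanSpace ℝ (Fin n) → ℝ := fun x => max (f x - δ x) 0 + min (f x + δ x) 0
    have hF : Continuous F := by
      have := hδ.continuous
      fun_prop
    have hFf : ∀ x, |F x - f x| ≤ δ x := by
      intro x
      have h0 := hδ0 x
      simp only [F]
      rw [abs_le]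
      rcases max_cases (f x - δ x) 0 with ⟨h1, h2⟩ | ⟨h1, h2⟩ <;>
      rcases min_cases (f x + δ x) 0 with ⟨h3, h4⟩ | ⟨h3, h4⟩ <;>
      rw [h1, h3] <;> constructor <;> linarith
    have hFsupp : tsupport F ⊆ V₁ := by
      have h1 : tsupport F ⊆ {x | δ x ≤ |f x|} := by
        refine closure_minimal (fun x hx => ?_) (isClosed_le hδ.continuous hf.abs)
        by_contra h
        rw [Set.mem_ofPred_eq, not_le, abs_lt] at h
        apply hx
        simp only [F]
        rw [max_eq_right (by linarith), min_eq_right (by linarith), add_zero]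
      refine h1.trans fun x hx => hsupp ?_
      rw [Function.mem_support, ← abs_pos]
      exact (hδ0 x).trans_le hx
    have hFL : ∀ κ : NNReal, LipschitzWith κ f → LipschitzWith (4 * κ₀) F := by
      intro κ hκ
      have h1 := (hκ₀f κ hκ).1
      have h2 := ((h1.sub hδL).max_const 0).add ((h1.add hδL).min_const 0)
      refine h2.weaken (le_of_eq ?_)
      ring
    obtain ⟨V', hV', hFV', hV'V₁⟩ := normal_exists_closure_subset (isClosed_tsupport F) hV₁ hFsupp
    obtain ⟨r, hr, -, hr0, hrP, hrL⟩ := exists_contDiff_small (E := EuclideanSpace ℝ (Fin n))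
      isOpen_univ (fun y s => ∀ z, dist z y ≤ s → |F z - F y| ≤ ε y / 4 ∧ (y ∉ V' → F z = 0))
      (fun x _ => by
        have e1 : ∀ᶠ z in 𝓝 x, |F z - F x| < ε x / 16 :=
          (hF.continuousAt.sub continuousAt_const).abs.eventually_lt continuousAt_const
            (by show |F x - F x| < ε x / 16; rw [sub_self, abs_zero]; linarith [hε0 x])
        have e2 : ∀ᶠ z in 𝓝 x, ε x / 2 < ε z :=
          continuousAt_const.eventually_lt hε.continuousAt (by linarith [hε0 x])
        have e3 : ∀ᶠ z in 𝓝 x, z ∈ V' ∨ x ∉ V' := by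
          by_cases hx : x ∈ V'
          · filter_upwards [hV'.mem_nhds hx] with z hz using Or.inl hz
          · exact Eventually.of_forall fun z => Or.inr hx
        have e4 : ∀ᶠ z in 𝓝 x, x ∈ V' ∨ F z = 0 := by
          by_cases hx : x ∈ V'
          · exact Eventually.of_forall fun z => Or.inl hx
          · have hx' : x ∉ tsupport F := fun h => hx (hFV' h)
            filter_upwards [(isClosed_tsupport F).isOpen_compl.mem_nhds hx'] with z hz
            exact Or.inr (image_eq_zero_of_notMem_tsupport hz)
        obtain ⟨ρ, hρ, hρ'⟩ := Metric.eventually_nhds_iff.1 (e1.and (e2.and (e3.and e4)))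
        refine ⟨ρ / 2, half_pos hρ, ?_⟩
        filter_upwards [ball_mem_nhds x (half_pos hρ)] with y hy s _ hs z hz
        rw [mem_ball] at hy
        obtain ⟨a1, a2, a3, a4⟩ := hρ' (y := y) (by linarith)
        obtain ⟨b1, b2, b3, b4⟩ := hρ' (y := z) (by linarith [dist_triangle z y x])
        refine ⟨?_, fun h => b4.resolve_left (a3.resolve_left h)⟩
        have := abs_sub_le (F z) (F x) (F y)
        rw [abs_sub_comm (F x) (F y)] at this
        linarith) one_pos
    replace hr0 : ∀ x, 0 < r x := fun x => (hr0 x).1 trivial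
    replace hrP := fun x => hrP x trivial
    obtain ⟨g, hg, hgF, hgL⟩ := exists_contDiff_mollification hF hr hr0
    refine ⟨g, hg, fun x => ?_, ?_, fun κ hκ => ?_⟩
    · have h1 := hgF x (F x) (ε x / 4) fun z hz => (hrP x z hz).1
      have h2 := abs_sub_le (f x) (F x) (g x)
      have h3 := hFf x
      rw [abs_sub_comm] at h1 h3
      linarith [hδε x, hε0 x]
    · refine Set.Subset.trans (closure_mono fun x hx => ?_) hV'V₁
      by_contra hxV'
      apply hx
      have := hgF x 0 0 fun z hz => by simp [(hrP x z hz).2 hxV']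
      simpa using this
    · refine (hgL _ (hFL κ hκ) hrL).weaken ?_
      calc 2 * (4 * κ₀) = 8 * κ₀ := by ring
        _ ≤ _ := (hκ₀f κ hκ).2

theorem FlatNear.eventually_eq_of_mem_normalSp {n d p : ℕ} (hp : 1 ≤ p)
    {M : Set (EuclideanSpace ℝ (Fin n))} (hM : IsCpManifold n ((p : ℕ∞) + 1) d M)
    {g : EuclideanSpace ℝ (Fin n) → ℝ} (hg : FlatNear g M) {x v : EuclideanSpace ℝ (Fin n)}
    (hx : x ∈ M) (hv : v ∈ normalSp n M x) : ∀ᶠ t : ℝ in 𝓝 0, g (x + t • v) = g x := by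
  obtain ⟨P, -, hP, hPv⟩ := hM.exists_local_projection hp hx
  have hT : Tendsto (fun t : ℝ => x + t • v) (𝓝 0) (𝓝 x) :=
    Continuous.tendsto' (by fun_prop) _ _ (by simp)
  filter_upwards [hT.eventually hP, hPv v hv, hT.eventually (hg x hx)] with t h1 h2 h3
  exact h3 x (by rw [h1, h2]; rfl)

theorem gradient_mem_tangentSp {n : ℕ} {M : Set (EuclideanSpace ℝ (Fin n))}
    {g : EuclideanSpace ℝ (Fin n) → ℝ} {x : EuclideanSpace ℝ (Fin n)}
    (hg : DifferentiableAt ℝ g x)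
    (h : ∀ v ∈ normalSp n M x, ∀ᶠ t : ℝ in 𝓝 0, g (x + t • v) = g x) :
    gradient g x ∈ tangentSp n M x := by
  have hcl : (tangentSp n M x)ᗮᗮ = tangentSp n M x := Submodule.orthogonal_orthogonal _
  rw [← hcl, Submodule.mem_orthogonal']
  intro v hv
  have h1 : HasDerivAt (fun t : ℝ => g (x + t • v)) (fderiv ℝ g x v) 0 :=
    hg.hasFDerivAt.hasLineDerivAt v
  have h2 : HasDerivAt (fun t : ℝ => g (x + t • v)) 0 0 :=
    (hasDerivAt_const (0 : ℝ) (g x)).congr_of_eventuallyEq (h v hv)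
  rw [gradient, InnerProductSpace.toDual_symm_apply]
  exact h1.unique h2

/-- Flattening a function near all the strata of a set of strata closed under passing to strata
of the frontier. -/
theorem CpStratification.exists_flatNear {n p : ℕ} (hp : 1 ≤ p)
    {Q : Set (EuclideanSpace ℝ (Fin n))} (hQ : IsClosed Q)
    (A : CpStratification n ((p : ℕ∞) + 1) Q) (hNF : NormallyFlat A)
    {f ε : EuclideanSpace ℝ (Fin n) → ℝ} (hf : Continuous f) (hε : Continuous ε)
    (hε0 : ∀ x, 0 < ε x) {V₁ : Set (EuclideanSpace ℝ (Fin n))} (hV₁ : IsOpen V₁)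
    (hsupp : Function.support f ⊆ V₁) (m : ℕ) :
    ∀ S ⊆ A.strata, S.card = m →
      (∀ M ∈ S, ∀ L ∈ A.strata, L ≠ M → (L ∩ closure M).Nonempty → L ∈ S) →
      ∃ g : EuclideanSpace ℝ (Fin n) → ℝ, ContDiff ℝ p g ∧ (∀ x, |f x - g x| < ε x) ∧
        tsupport g ⊆ V₁ ∧
        (∀ κ : NNReal, LipschitzWith κ f → LipschitzWith (13 ^ (m + 1) * κ) g) ∧
        ∀ L ∈ S, FlatNear g L := by
  classical
  induction m with
  | zero =>
    intro S _ hcard _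
    obtain ⟨g, hg, hfg, hgV, hgL⟩ := exists_contDiff_approx hf hε hε0 hV₁ hsupp
    refine ⟨g, hg.of_le (by exact_mod_cast le_top), hfg, hgV, by simpa using hgL, ?_⟩
    rw [Finset.card_eq_zero.1 hcard]
    simp
  | succ m ih =>
    intro S hSA hcard hdown
    have hne : S.Nonempty := Finset.card_pos.1 (by lia)
    obtain ⟨M, hMS, hmax⟩ := S.exists_max_image A.dim hne
    have hMA := hSA hMS
    have hTA : S.erase M ⊆ A.strata := (S.erase_subset M).trans hSA
    have hTdown : ∀ N ∈ S.erase M, ∀ L ∈ A.strata, L ≠ N → (L ∩ closure N).Nonempty →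
        L ∈ S.erase M := by
      intro N hN L hL hLN hLN'
      have hNS := Finset.mem_of_mem_erase hN
      refine Finset.mem_erase.2 ⟨?_, hdown N hNS L hL hLN hLN'⟩
      rintro rfl
      exact absurd (A.dim_lt L hL N (hSA hNS) hLN
        (A.frontierCond L hL N (hSA hNS) hLN hLN')) (not_lt.2 (hmax N hNS))
    obtain ⟨g, hg, hfg, hgV, hgL, hgflat⟩ := ih (S.erase M) hTA
      (by rw [Finset.card_erase_of_mem hMS, hcard]; rfl) hTdown
    have hfrontier : ∀ N ∈ A.strata, closure N ⊆ Q := by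
      intro N hN
      refine closure_minimal ?_ hQ
      rw [← A.covers]
      exact Set.subset_sUnion_of_mem hN
    have hclosed : IsClosed (⋃₀ ((S.erase M : Finset (Set (EuclideanSpace ℝ (Fin n)))) :
        Set (Set (EuclideanSpace ℝ (Fin n))))) := by
      rw [← closure_subset_iff_isClosed, Set.sUnion_eq_biUnion,
        (Finset.finite_toSet _).closure_biUnion, ← Set.sUnion_eq_biUnion]
      refine Set.iUnion₂_subset fun N hN x hx => ?_
      have hN' : N ∈ S.erase M := hN
      have hxQ := hfrontier N (hTA hN') hx
      rw [← A.covers] at hxQ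
      obtain ⟨L, hL, hxL⟩ := hxQ
      by_cases hLN : L = N
      · exact ⟨N, hN, hLN ▸ hxL⟩
      · exact ⟨L, hTdown N hN' L hL hLN ⟨x, hxL, hx⟩, hxL⟩
    have hdisj : Disjoint (⋃₀ ((S.erase M : Finset (Set (EuclideanSpace ℝ (Fin n)))) :
        Set (Set (EuclideanSpace ℝ (Fin n))))) M := by
      rw [Set.disjoint_sUnion_left]
      intro L hL
      have hL' : L ∈ S.erase M := hL
      exact A.pairwiseDisjoint L (hTA hL') M hMA (Finset.ne_of_mem_erase hL')
    have hfr : closure M \ M ⊆ ⋃₀ ((S.erase M : Finset (Set (EuclideanSpace ℝ (Fin n)))) :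
        Set (Set (EuclideanSpace ℝ (Fin n)))) := by
      rintro x ⟨hx, hxM⟩
      have hxQ := hfrontier M hMA hx
      rw [← A.covers] at hxQ
      obtain ⟨L, hL, hxL⟩ := hxQ
      have hLM : L ≠ M := by
        rintro rfl
        exact hxM hxL
      exact ⟨L, Finset.mem_erase.2 ⟨hLM, hdown M hMS L hL hLM ⟨x, hxL, hx⟩⟩, hxL⟩
    obtain ⟨G, hG, hgG, hGV, hGL, hGflat, hGM⟩ := exists_flatNear_insert hp (A.isManifold M hMA)
      hclosed hdisj hfr (fun L hL x hx => (A.isManifold L (hTA hL)).eventually_metricProj_nonempty hx)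
      (fun L hL hLM => hNF L (hTA hL) M hMA
        (A.frontierCond L (hTA hL) M hMA (Finset.ne_of_mem_erase hL) hLM))
      (Finset.finite_toSet _) hg (hε.sub (hf.sub hg.continuous).abs)
      (fun x => sub_pos.2 (hfg x)) hgflat hV₁ hgV
    refine ⟨G, hG, fun x => ?_, hGV, fun κ hκ => ?_, fun L hL => ?_⟩
    · have h1 := hgG x
      have h2 := abs_sub_le (f x) (g x) (G x)
      simp only [Pi.sub_apply] at h1
      linarith
    · have := hGL _ (hgL κ hκ)
      rwa [← mul_assoc, ← pow_succ'] at this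
    · by_cases hLM : L = M
      · exact hLM ▸ hGM
      · exact hGflat L (Finset.mem_erase.2 ⟨hLM, hL⟩)

/-- **C^p approximation on normally flat stratifications.** -/
theorem approximation_on_normally_flat_stratifications
    (n m : ℕ) (p : ℕ) (hp : 1 ≤ p)
    (Q : Set (EuclideanSpace ℝ (Fin n))) (hQ : IsClosed Q)
    (f ε : EuclideanSpace ℝ (Fin n) → ℝ)
    (hf : Continuous f) (hε : Continuous ε) (hε0 : ∀ x, 0 < ε x)
    (A : CpStratification n ((p : ℕ∞) + 1) Q) (hm : A.strata.card = m)
    (hNF : NormallyFlat A)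
    (V₁ : Set (EuclideanSpace ℝ (Fin n))) (hV₁ : IsOpen V₁)
    (hsupp : Function.support f ⊆ V₁) :
    ∃ g : EuclideanSpace ℝ (Fin n) → ℝ,
      ContDiff ℝ p g ∧
      (∀ x, |f x - g x| < ε x) ∧
      (∀ M ∈ A.strata, ∀ x ∈ M, gradient g x ∈ tangentSp n M x) ∧
      (∀ κ : NNReal, LipschitzWith κ f → LipschitzWith (13 ^ (m + 1) * κ) g) ∧
      Function.support g ⊆ V₁ ∧
      (∀ M ∈ A.strata, ∀ x ∈ M, ∀ v ∈ normalSp n M x,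
        ∃ η > 0, ∀ t : ℝ, |t| < η → g (x + t • v) = g x) := by
  obtain ⟨g, hg, hfg, hgV, hgL, hgflat⟩ := A.exists_flatNear hp hQ hNF hf hε hε0 hV₁ hsupp m
    A.strata subset_rfl hm fun _ _ L hL _ _ => hL
  have hnormal : ∀ M ∈ A.strata, ∀ x ∈ M, ∀ v ∈ normalSp n M x,
      ∀ᶠ t : ℝ in 𝓝 0, g (x + t • v) = g x := fun M hM x hx v hv =>
    (hgflat M hM).eventually_eq_of_mem_normalSp hp (A.isManifold M hM) hx hv
  have hp0 : (p : WithTop ℕ∞) ≠ 0 := by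
    have : p ≠ 0 := by lia
    exact_mod_cast this
  refine ⟨g, hg, hfg, fun M hM x hx => ?_, hgL, (subset_tsupport g).trans hgV,
    fun M hM x hx v hv => ?_⟩
  · exact gradient_mem_tangentSp (hg.differentiable hp0 x) (hnormal M hM x hx)
  · obtain ⟨η, hη, h⟩ := Metric.eventually_nhds_iff.1 (hnormal M hM x hx v hv)
    exact ⟨η, hη, fun t ht => h (by simpa using ht)⟩

end
end

section
/- Let M ⊆ ℝⁿ be a C² manifold, let f : M → ℝ be κ-Lipschitz on M, let ε : M → (0,∞) be continuous, and let r > 0. Then there exists a function f̂ : M → ℝ that is (κ + r)-Lipschitz on M, is C^∞-smooth on M (i.e., for every x ∈ M there is an open neighborhood U of x in ℝⁿ and a C^∞-smooth function F : ℝⁿ → ℝ agreeing with f̂ on M ∩ U), and satisfies |f(x) − f̂(x)| < ε(x) for all x ∈ M. -/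
open Filter Topology Metric

noncomputable section

open Set Function MeasureTheory Module
open scoped ContDiff NNReal Convolution

/-- A smooth compactly supported function becomes, after multiplication by a small positive
constant, arbitrarily small together with its first `N` derivatives. -/
theorem exists_pos_forall_norm_iteratedFDeriv_smul_le {E : Type*} [NormedAddCommGroup E]
    [NormedSpace ℝ E] {g : E → ℝ} (hg : ContDiff ℝ ∞ g) (hc : HasCompactSupport g) (N : ℕ)
    {d : ℝ} (hd : 0 < d) :
    ∃ t : ℝ, 0 < t ∧ t ≤ d ∧ ∀ i ≤ N, ∀ x, ‖iteratedFDeriv ℝ i (t • g) x‖ ≤ d := by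
  have hbound : ∀ i : ℕ, ∃ R, ∀ x, ‖iteratedFDeriv ℝ i g x‖ ≤ R := fun i ↦
    (hc.iteratedFDeriv i).exists_bound_of_continuous
      (hg.continuous_iteratedFDeriv (mod_cast le_top))
  choose R hR using hbound
  set A : ℝ := 1 + ∑ i ∈ Finset.range (N + 1), |R i|
  have hsum : 0 ≤ ∑ i ∈ Finset.range (N + 1), |R i| := Finset.sum_nonneg fun i _ ↦ abs_nonneg _
  have hA1 : 1 ≤ A := by linarith
  have hA0 : 0 < A := by linarith
  refine ⟨d / A, by positivity, div_le_self hd.le hA1, fun i hi x ↦ ?_⟩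
  have hRA : R i ≤ A := by
    have := Finset.single_le_sum (f := fun i ↦ |R i|) (fun j _ ↦ abs_nonneg _)
      (Finset.mem_range.2 (Nat.lt_succ_of_le hi))
    have := le_abs_self (R i)
    linarith
  rw [iteratedFDeriv_const_smul_apply (hg.contDiffAt.of_le (mod_cast le_top)), norm_smul,
    Real.norm_of_nonneg (by positivity)]
  calc d / A * ‖iteratedFDeriv ℝ i g x‖ ≤ d / A * A := by gcongr; exact (hR i x).trans hRA
    _ = d := by field_simp

/-- A positive continuous function on an arbitrary subset of a finite-dimensional space dominates
a globally smooth nonnegative function with small Lipschitz constant, positive on the subset. -/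
theorem exists_contDiff_lipschitzWith_pos_le {E : Type*} [NormedAddCommGroup E] [NormedSpace ℝ E]
    [FiniteDimensional ℝ E] {s : Set E} {e : E → ℝ} (he : ContinuousOn e s)
    (he0 : ∀ x ∈ s, 0 < e x) {η : ℝ≥0} (hη : 0 < η) :
    ∃ δ : E → ℝ, ContDiff ℝ ∞ δ ∧ LipschitzWith η δ ∧ (∀ x, 0 ≤ δ x) ∧
      ∀ x ∈ s, 0 < δ x ∧ δ x ≤ e x := by
  let ι := {g : E → ℝ // HasCompactSupport g ∧ ContDiff ℝ ∞ g ∧ range g ⊆ Icc 0 1 ∧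
    ∃ c : ℝ, 0 < c ∧ ∀ x ∈ s, x ∈ support g → c ≤ e x}
  have hcover : ∀ x ∈ s, ∃ g : ι, x ∈ support g.1 := by
    intro x hx
    have hev : ∀ᶠ y in 𝓝 x, y ∈ s → e x / 2 < e y :=
      eventually_nhdsWithin_iff.1 ((he x hx).eventually (lt_mem_nhds (half_lt_self (he0 x hx))))
    obtain ⟨g, hgs, hgc, hgd, hgr, hgx⟩ := exists_contDiff_tsupport_subset (n := ⊤) hev
    exact ⟨⟨g, hgc, hgd, hgr, e x / 2, half_pos (he0 x hx),
      fun y hy hyg ↦ (hgs (subset_tsupport g hyg) hy).le⟩, by simp [hgx]⟩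
  obtain ⟨T, hTc, hT⟩ := TopologicalSpace.isOpen_iUnion_countable (fun g : ι ↦ support g.1)
    fun g ↦ g.2.2.1.continuous.isOpen_support
  let z : ι := ⟨0, HasCompactSupport.zero, contDiff_const, by rintro _ ⟨x, rfl⟩; simp, 1, one_pos,
    by simp⟩
  obtain ⟨g0, hg0⟩ := (hTc.insert z).exists_eq_range (insert_nonempty z T)
  have hs_g : ∀ x ∈ s, ∃ n, x ∈ support (g0 n).1 := by
    intro x hx
    have hx' : x ∈ ⋃ g ∈ T, support g.1 := by rw [hT]; exact mem_iUnion.2 (hcover x hx)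
    obtain ⟨g, hgT, hxg⟩ := mem_iUnion₂.1 hx'
    have hgr : g ∈ range g0 := hg0 ▸ mem_insert_of_mem z hgT
    obtain ⟨n, rfl⟩ := hgr
    exact ⟨n, hxg⟩
  have hg_nonneg : ∀ n x, 0 ≤ (g0 n).1 x := fun n x ↦ ((g0 n).2.2.2.1 (mem_range_self x)).1
  have hg_le : ∀ n x, (g0 n).1 x ≤ 1 := fun n x ↦ ((g0 n).2.2.2.1 (mem_range_self x)).2
  choose c hc0 hc using fun n ↦ (g0 n).2.2.2.2
  obtain ⟨d, hd0, a, hda, haη⟩ :=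
    NNReal.exists_pos_sum_of_countable (ε := min η 1) (lt_min hη one_pos).ne' ℕ
  have hda' : HasSum (fun n ↦ (d n : ℝ)) a := NNReal.hasSum_coe.2 hda
  have ha1 : (a : ℝ) ≤ 1 := mod_cast (haη.trans_le (min_le_right _ _)).le
  have haη' : a ≤ η := (haη.trans_le (min_le_left _ _)).le
  have hd0' : ∀ n, (0 : ℝ) < d n := fun n ↦ mod_cast hd0 n
  choose t ht0 htd ht using fun n ↦ exists_pos_forall_norm_iteratedFDeriv_smul_le (g0 n).2.2.1
    (g0 n).2.1 (n + 1) (mul_pos (hd0' n) (lt_min (hc0 n) one_pos))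
  have hmin : ∀ n, d n * min (c n) 1 ≤ d n := fun n ↦
    mul_le_of_le_one_right (hd0' n).le (min_le_right _ _)
  have hsummable : ∀ x, Summable fun n ↦ (t n • (g0 n).1) x := fun x ↦ by
    refine .of_norm_bounded hda'.summable fun n ↦ ?_
    have := (ht n 0 (Nat.zero_le _) x).trans (hmin n)
    rwa [norm_iteratedFDeriv_zero] at this
  have hterm : ∀ n x, 0 ≤ (t n • (g0 n).1) x := fun n x ↦ mul_nonneg (ht0 n).le (hg_nonneg n x)
  refine ⟨fun x ↦ ∑' n, (t n • (g0 n).1) x, ?_, ?_, fun x ↦ tsum_nonneg fun n ↦ hterm n x, ?_⟩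
  · refine contDiff_tsum_of_eventually (v := fun _ n ↦ (d n : ℝ))
      (fun n ↦ (g0 n).2.2.1.const_smul (t n)) (fun k _ ↦ hda'.summable) ?_
    intro i _
    rw [Nat.cofinite_eq_atTop, eventually_atTop]
    exact ⟨i, fun n hn x ↦ (ht n i (by lia) x).trans (hmin n)⟩
  · refine LipschitzWith.of_dist_le_mul fun x y ↦ ?_
    have hlip : ∀ n, LipschitzWith (d n) (t n • (g0 n).1) := fun n ↦ by
      refine lipschitzWith_of_nnnorm_fderiv_le (𝕜 := ℝ)
        (((g0 n).2.2.1.const_smul (t n)).differentiable (by simp)) fun x ↦ ?_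
      have := (ht n 1 (by lia) x).trans (hmin n)
      rw [norm_iteratedFDeriv_one] at this
      exact_mod_cast this
    rw [dist_eq_norm, ← (hsummable x).tsum_sub (hsummable y)]
    refine (tsum_of_norm_bounded (hda'.mul_right (dist x y)) fun n ↦ ?_).trans
      (by gcongr)
    rw [← dist_eq_norm]
    exact (hlip n).dist_le_mul x y
  · intro x hx
    obtain ⟨m, hm⟩ := hs_g x hx
    refine ⟨(hsummable x).tsum_pos (fun n ↦ hterm n x) m
      (mul_pos (ht0 m) ((hg_nonneg m x).lt_of_ne' hm)), ?_⟩
    have hle : ∀ n, (t n • (g0 n).1) x ≤ d n * e x := by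
      intro n
      by_cases hxn : x ∈ support (g0 n).1
      · calc t n * (g0 n).1 x ≤ t n * 1 := mul_le_mul_of_nonneg_left (hg_le n x) (ht0 n).le
          _ = t n := mul_one _
          _ ≤ d n * min (c n) 1 := htd n
          _ ≤ d n * e x := mul_le_mul_of_nonneg_left ((min_le_left _ _).trans (hc n x hx hxn))
            (hd0' n).le
      · have : (g0 n).1 x = 0 := notMem_support.1 hxn
        simp only [Pi.smul_apply, this, smul_zero]
        exact mul_nonneg (hd0' n).le (he0 x hx).le
    calc ∑' n, (t n • (g0 n).1) x ≤ a * e x :=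
          (hsummable x).tsum_le_of_sum_le fun u ↦
            (Finset.sum_le_sum fun n _ ↦ hle n).trans
              (sum_le_hasSum u (fun n _ ↦ mul_nonneg (hd0' n).le (he0 x hx).le)
                (hda'.mul_right (e x)))
      _ ≤ e x := mul_le_of_le_one_left (he0 x hx).le ha1

section VariableMollification

variable {E : Type*} [NormedAddCommGroup E] [NormedSpace ℝ E] [FiniteDimensional ℝ E]
  [MeasurableSpace E] [BorelSpace E] (μ : Measure E) [μ.IsAddHaarMeasure]

/-- The average of `f` around `x` against the bump function `φ` rescaled by the factor `δ x`. -/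
def variableMollification (φ : ContDiffBump (0 : E)) (δ f : E → ℝ) (x : E) : ℝ :=
  ∫ y, f (x - δ x • y) * φ.normed μ y ∂μ

/-- The average of a continuous function against a normalized bump function is bounded by any bound
of the function on the support of the bump. -/
theorem ContDiffBump.abs_integral_mul_normed_le (φ : ContDiffBump (0 : E)) {h : E → ℝ} {C : ℝ}
    (hC : ∀ y ∈ ball (0 : E) φ.rOut, |h y| ≤ C) : |∫ y, h y * φ.normed μ y ∂μ| ≤ C := by
  have hint : Integrable (fun y ↦ C * φ.normed μ y) μ := φ.integrable_normed.const_mul C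
  calc |∫ y, h y * φ.normed μ y ∂μ| ≤ ∫ y, C * φ.normed μ y ∂μ := by
        rw [← Real.norm_eq_abs]
        refine norm_integral_le_of_norm_le hint (ae_of_all _ fun y ↦ ?_)
        by_cases hy : y ∈ ball (0 : E) φ.rOut
        · rw [norm_mul, Real.norm_eq_abs, Real.norm_of_nonneg (φ.nonneg_normed y)]
          exact mul_le_mul_of_nonneg_right (hC y hy) (φ.nonneg_normed y)
        · rw [← φ.support_normed_eq (μ := μ), notMem_support] at hy
          simp [hy]
    _ = C := by rw [integral_const_mul, φ.integral_normed, mul_one]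

variable {μ} {φ : ContDiffBump (0 : E)} {δ f : E → ℝ} {K : ℝ≥0}

theorem integrable_comp_sub_smul_mul_normed (hf : Continuous f) (x : E) (t : ℝ) :
    Integrable (fun y ↦ f (x - t • y) * φ.normed μ y) μ :=
  Continuous.integrable_of_hasCompactSupport
    ((by fun_prop : Continuous fun y ↦ f (x - t • y)).mul φ.continuous_normed)
    φ.hasCompactSupport_normed.mul_left

theorem abs_variableMollification_sub_le (hf : LipschitzWith K f) (hφ : φ.rOut ≤ 1) (x x' : E) :
    |variableMollification μ φ δ f x - variableMollification μ φ δ f x'| ≤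
      K * (‖x - x'‖ + |δ x - δ x'|) := by
  rw [variableMollification, variableMollification,
    ← integral_sub (integrable_comp_sub_smul_mul_normed hf.continuous _ _)
      (integrable_comp_sub_smul_mul_normed hf.continuous _ _)]
  simp_rw [← sub_mul]
  refine φ.abs_integral_mul_normed_le μ fun y hy ↦ ?_
  have hy1 : ‖y‖ ≤ 1 := (mem_ball_zero_iff.1 hy).le.trans hφ
  have h := hf.dist_le_mul (x - δ x • y) (x' - δ x' • y)
  rw [Real.dist_eq, dist_eq_norm] at h
  refine h.trans (mul_le_mul_of_nonneg_left ?_ K.2)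
  calc ‖x - δ x • y - (x' - δ x' • y)‖ = ‖(x - x') - (δ x - δ x') • y‖ := by
        congr 1; rw [sub_smul]; abel
    _ ≤ ‖x - x'‖ + |δ x - δ x'| * ‖y‖ := by
        refine (norm_sub_le _ _).trans_eq ?_
        rw [norm_smul, Real.norm_eq_abs]
    _ ≤ ‖x - x'‖ + |δ x - δ x'| := by
        gcongr; exact mul_le_of_le_one_right (abs_nonneg _) hy1

theorem abs_sub_variableMollification_le (hf : LipschitzWith K f) (hφ : φ.rOut ≤ 1) (x : E) :
    |f x - variableMollification μ φ δ f x| ≤ K * |δ x| := by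
  have hconst : f x = ∫ y, f x * φ.normed μ y ∂μ := by
    rw [integral_const_mul, φ.integral_normed, mul_one]
  rw [variableMollification, hconst, ← integral_sub (φ.integrable_normed.const_mul _)
      (integrable_comp_sub_smul_mul_normed hf.continuous _ _)]
  simp_rw [← sub_mul]
  refine φ.abs_integral_mul_normed_le μ fun y hy ↦ ?_
  have hy1 : ‖y‖ ≤ 1 := (mem_ball_zero_iff.1 hy).le.trans hφ
  have h := hf.dist_le_mul x (x - δ x • y)
  rw [Real.dist_eq, dist_eq_norm, sub_sub_cancel, norm_smul, Real.norm_eq_abs] at h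
  exact h.trans (mul_le_mul_of_nonneg_left (mul_le_of_le_one_right (abs_nonneg _) hy1) K.2)

theorem variableMollification_eq_convolution {x : E} (hx : 0 < δ x) :
    variableMollification μ φ δ f x =
      (f ⋆[ContinuousLinearMap.mul ℝ ℝ, μ]
        fun z ↦ (δ x ^ finrank ℝ E)⁻¹ * φ.normed μ ((δ x)⁻¹ • z)) x := by
  have h := Measure.integral_comp_smul μ
    (fun z ↦ f (x - z) * φ.normed μ ((δ x)⁻¹ • z)) (δ x)
  simp only [inv_smul_smul₀ hx.ne'] at h
  rw [variableMollification, h, convolution_eq_swap, abs_of_pos (by positivity), smul_eq_mul,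
    ← integral_const_mul]
  refine integral_congr_ae (ae_of_all _ fun z ↦ ?_)
  simp only [ContinuousLinearMap.mul_apply']
  ring

theorem contDiffOn_variableMollification (hf : Continuous f) (hδ : ContDiff ℝ ∞ δ) :
    ContDiffOn ℝ ∞ (variableMollification μ φ δ f) {x | 0 < δ x} := by
  intro x hx
  have hx : 0 < δ x := hx
  let g : ℝ → E → ℝ := fun t z ↦ (t ^ finrank ℝ E)⁻¹ * φ.normed μ (t⁻¹ • z)
  have hg : ContDiffOn ℝ ∞ ↿g (Ioo 0 (2 * δ x) ×ˢ univ) := by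
    have hne : ∀ p ∈ Ioo 0 (2 * δ x) ×ˢ (univ : Set E), p.1 ≠ 0 := fun p hp ↦ hp.1.1.ne'
    have hinv : ContDiffOn ℝ ∞ (fun p : ℝ × E ↦ p.1⁻¹) (Ioo 0 (2 * δ x) ×ˢ univ) :=
      contDiff_fst.contDiffOn.inv hne
    exact ((contDiff_fst.pow _).contDiffOn.inv fun p hp ↦ pow_ne_zero _ (hne p hp)).mul
      (φ.contDiff_normed.comp_contDiffOn (hinv.smul contDiff_snd.contDiffOn))
  have hgs : ∀ t z, t ∈ Ioo 0 (2 * δ x) → z ∉ closedBall (0 : E) (2 * δ x * φ.rOut) →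
      g t z = 0 := by
    intro t z ht hz
    have : φ.normed μ (t⁻¹ • z) = 0 := by
      rw [← notMem_support, φ.support_normed_eq, mem_ball_zero_iff, norm_smul, norm_inv,
        Real.norm_of_nonneg ht.1.le, not_lt, ← div_eq_inv_mul, le_div_iff₀ ht.1]
      rw [mem_closedBall_zero_iff, not_le] at hz
      nlinarith [φ.rOut_pos, ht.2]
    simp [g, this]
  have hconv := contDiffOn_convolution_right_with_param (n := ⊤) (μ := μ)
    (ContinuousLinearMap.mul ℝ ℝ) isOpen_Ioo (isCompact_closedBall _ _) hgs
    hf.locallyIntegrable hg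
  have hmem : ((δ x, x) : ℝ × E) ∈ Ioo 0 (2 * δ x) ×ˢ (univ : Set E) :=
    ⟨⟨hx, by linarith⟩, mem_univ _⟩
  have hat := hconv.contDiffAt ((isOpen_Ioo.prod isOpen_univ).mem_nhds hmem)
  have hcomp := ContDiffAt.comp x (f := fun x ↦ (δ x, x)) hat
    (hδ.contDiffAt.prodMk contDiffAt_id)
  refine (hcomp.congr_of_eventuallyEq ?_).contDiffWithinAt
  filter_upwards [hδ.continuous.continuousAt.eventually (lt_mem_nhds hx)] with y hy
  exact variableMollification_eq_convolution hy

end VariableMollification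

/-- A function that is smooth on an open set agrees near each of its points with a globally smooth
function. -/
theorem ContDiffOn.exists_contDiff_eqOn_nhds {E : Type*} [NormedAddCommGroup E] [NormedSpace ℝ E]
    [FiniteDimensional ℝ E] {G : E → ℝ} {W : Set E} (hG : ContDiffOn ℝ ∞ G W) (hW : IsOpen W)
    {x : E} (hx : x ∈ W) :
    ∃ U : Set E, IsOpen U ∧ x ∈ U ∧ ∃ F : E → ℝ, ContDiff ℝ ∞ F ∧ EqOn G F U := by
  obtain ⟨R, hR, hRW⟩ := nhds_basis_closedBall.mem_iff.1 (hW.mem_nhds hx)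
  let ψ : ContDiffBump x := ⟨R / 2, R, half_pos hR, half_lt_self hR⟩
  refine ⟨ball x (R / 2), isOpen_ball, mem_ball_self (half_pos hR), fun y ↦ ψ y * G y, ?_, ?_⟩
  · refine contDiff_iff_contDiffAt.2 fun y ↦ ?_
    by_cases hy : y ∈ tsupport ψ
    · rw [ψ.tsupport_eq] at hy
      exact ψ.contDiffAt.mul (hG.contDiffAt (hW.mem_nhds (hRW hy)))
    · refine (contDiffAt_const (c := 0)).congr_of_eventuallyEq ?_
      filter_upwards [notMem_tsupport_iff_eventuallyEq.1 hy] with z hz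
      simp [hz]
  · intro y hy
    simp [ψ.one_of_mem_closedBall (ball_subset_closedBall hy)]

/-- **Smooth approximation of Lipschitz functions on a manifold.** -/
theorem approximation_of_lipschitz_on_manifold
    (n : ℕ) (M : Set (EuclideanSpace ℝ (Fin n)))
    (hM : ∃ d : ℕ, IsCpManifold n 2 d M)
    (f : EuclideanSpace ℝ (Fin n) → ℝ) (κ : ℝ)
    (hf : ∀ x ∈ M, ∀ y ∈ M, |f x - f y| ≤ κ * ‖x - y‖)
    (ε : EuclideanSpace ℝ (Fin n) → ℝ) (hε : ContinuousOn ε M) (hε0 : ∀ x ∈ M, 0 < ε x)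
    (r : ℝ) (hr : 0 < r) :
    ∃ fhat : EuclideanSpace ℝ (Fin n) → ℝ,
      (∀ x ∈ M, ∀ y ∈ M, |fhat x - fhat y| ≤ (κ + r) * ‖x - y‖) ∧
      (∀ x ∈ M, ∃ U : Set (EuclideanSpace ℝ (Fin n)), IsOpen U ∧ x ∈ U ∧
        ∃ F : EuclideanSpace ℝ (Fin n) → ℝ, ContDiff ℝ (⊤ : ℕ∞) F ∧
          ∀ y ∈ M ∩ U, fhat y = F y) ∧
      (∀ x ∈ M, |f x - fhat x| < ε x) := by
  rcases M.subsingleton_or_nontrivial with hsub | ⟨a, ha, b, hb, hab⟩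
  · refine ⟨f, fun x hx y hy ↦ by simp [hsub hx hy], fun x hx ↦ ⟨univ, isOpen_univ, mem_univ x,
      fun _ ↦ f x, contDiff_const, fun y hy ↦ by rw [hsub hy.1 hx]⟩, fun x hx ↦ by
        simpa using hε0 x hx⟩
  have hκ : 0 ≤ κ := nonneg_of_mul_nonneg_left ((abs_nonneg _).trans (hf a ha b hb))
    (norm_pos_iff.2 (sub_ne_zero.2 hab))
  lift κ to ℝ≥0 using hκ
  lift r to ℝ≥0 using hr.le
  have hr0 : 0 < r := mod_cast hr
  obtain ⟨f', hf', hff'⟩ := (LipschitzOnWith.of_dist_le_mul (K := κ) (s := M) (f := f)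
    fun x hx y hy ↦ by rw [Real.dist_eq, dist_eq_norm]; exact hf x hx y hy).extend_real
  have hκ1 : (0 : ℝ) < κ + 1 := by positivity
  obtain ⟨δ, hδ, hδlip, hδ0, hδε⟩ := exists_contDiff_lipschitzWith_pos_le
    (hε.div_const ((κ : ℝ) + 1)) (fun x hx ↦ div_pos (hε0 x hx) hκ1)
    (show 0 < r / (κ + 1) by positivity)
  let φ : ContDiffBump (0 : EuclideanSpace ℝ (Fin n)) := ⟨1 / 2, 1, by norm_num, by norm_num⟩
  refine ⟨variableMollification volume φ δ f', fun x _ y _ ↦ ?_, fun x hx ↦ ?_, fun x hx ↦ ?_⟩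
  · refine (abs_variableMollification_sub_le hf' le_rfl x y).trans ?_
    have h := hδlip.dist_le_mul x y
    rw [Real.dist_eq, dist_eq_norm] at h
    push_cast at h
    have hκr : (κ : ℝ) * (r / (κ + 1)) ≤ r := by
      rw [mul_div_assoc', div_le_iff₀ hκ1]
      nlinarith
    calc (κ : ℝ) * (‖x - y‖ + |δ x - δ y|)
        ≤ κ * (‖x - y‖ + r / (κ + 1) * ‖x - y‖) := by gcongr
      _ = (κ + κ * (r / (κ + 1))) * ‖x - y‖ := by ring
      _ ≤ (κ + r) * ‖x - y‖ := by gcongr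
  · obtain ⟨U, hU, hxU, F, hF, hGF⟩ :=
      (contDiffOn_variableMollification (μ := volume) (φ := φ) hf'.continuous
        hδ).exists_contDiff_eqOn_nhds (isOpen_lt continuous_const hδ.continuous) (hδε x hx).1
    exact ⟨U, hU, hxU, F, hF, fun y hy ↦ hGF hy.2⟩
  · obtain ⟨hpos, hle⟩ := hδε x hx
    rw [hff' hx]
    refine (abs_sub_variableMollification_le hf' le_rfl x).trans_lt ?_
    rw [abs_of_pos hpos]
    rw [le_div_iff₀ hκ1] at hle
    linarith

end
end
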